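/- For all real x ≥ 1, |ψ⁽¹⁾(x) − x²/2| ≤ 0.0462·x^{3/2} + 1.838·x, where ψ⁽¹⁾(x) = ∑_{n ≤ x} Λ(n)(x − n), assuming the Riemann Hypothesis. -/

import Mathlib

open ArithmeticFunction Real

/-- The integrated Chebyshev function `ψ⁽¹⁾(x) = ∑_{n ≤ x} Λ(n)(x − n)`. -/
noncomputable def psiOne (x : ℝ) : ℝ :=
  ∑ n ∈ Finset.Icc 1 ⌊x⌋₊, Λ n * (x - n)

section

open Filter Topology MeasureTheory Set
open scoped FourierTransform

theorem Differentiable.exists_eq_pow_mul {f : ℂ → ℂ} (hf : Differentiable ℂ f)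
    (hne : ∃ w, f w ≠ 0) (z : ℂ) :
    ∃ h : ℂ → ℂ, Differentiable ℂ h ∧ (∀ s, f s = (s - z) ^ analyticOrderNatAt f z * h s) ∧
      h z ≠ 0 := by
  have htop : analyticOrderAt f z ≠ ⊤ := by
    intro h
    rw [analyticOrderAt_eq_top] at h
    obtain ⟨w, hw⟩ := hne
    have hA : AnalyticOnNhd ℂ f Set.univ := fun s _ => hf.analyticAt s
    exact hw (hA.eqOn_zero_of_preconnected_of_eventuallyEq_zero isPreconnected_univ
      (Set.mem_univ z) h (Set.mem_univ w))
  obtain ⟨g, hg, hgz, hfg⟩ := ((hf.analyticAt z).analyticOrderAt_ne_top).1 htop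
  set n := analyticOrderNatAt f z
  refine ⟨fun w => if w = z then g z else f w / (w - z) ^ n, ?_, ?_, by simpa using hgz⟩
  · intro w
    by_cases hw : w = z
    · subst hw
      refine hg.differentiableAt.congr_of_eventuallyEq ?_
      filter_upwards [hfg] with v hv
      by_cases hvw : v = w
      · simp [hvw]
      · have : (v - w) ^ n ≠ 0 := pow_ne_zero _ (sub_ne_zero.2 hvw)
        simp only [hvw, if_false, hv, smul_eq_mul]
        field_simp
    · have : (w - z) ^ n ≠ 0 := pow_ne_zero _ (sub_ne_zero.2 hw)
      have h1 : DifferentiableAt ℂ (fun w => f w / (w - z) ^ n) w := by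
        have := hf w
        fun_prop (disch := assumption)
      refine h1.congr_of_eventuallyEq ?_
      filter_upwards [isOpen_ne.mem_nhds hw] with v hv
      simp [show v ≠ z from hv]
  · intro s
    by_cases hs : s = z
    · subst hs
      have := hfg.self_of_nhds
      simpa using this
    · have : (s - z) ^ n ≠ 0 := pow_ne_zero _ (sub_ne_zero.2 hs)
      simp only [hs, if_false]
      field_simp

theorem Differentiable.exists_eq_prod_pow_mul {f : ℂ → ℂ} (hf : Differentiable ℂ f)
    (hne : ∃ w, f w ≠ 0) (Z : Finset ℂ) :
    ∃ h : ℂ → ℂ, Differentiable ℂ h ∧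
      (∀ s, f s = (∏ z ∈ Z, (s - z) ^ analyticOrderNatAt f z) * h s) ∧ ∀ z ∈ Z, h z ≠ 0 := by
  classical
  induction Z using Finset.induction_on with
  | empty => exact ⟨f, hf, by simp, by simp⟩
  | insert z Z hz ih =>
    obtain ⟨h, hd, hfac, hnz⟩ := ih
    have hne' : ∃ w, h w ≠ 0 := by
      obtain ⟨w, hw⟩ := hne
      refine ⟨w, fun h0 => hw ?_⟩
      rw [hfac, h0, mul_zero]
    obtain ⟨k, kd, kfac, knz⟩ := hd.exists_eq_pow_mul hne' z
    have hord : analyticOrderNatAt f z = analyticOrderNatAt h z := by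
      have hP : AnalyticAt ℂ (fun s : ℂ => ∏ z ∈ Z, (s - z) ^ analyticOrderNatAt f z) z :=
        Differentiable.analyticAt (by fun_prop) z
      have hP0 : analyticOrderAt (fun s : ℂ => ∏ z ∈ Z, (s - z) ^ analyticOrderNatAt f z) z = 0 := by
        rw [hP.analyticOrderAt_eq_zero]
        refine Finset.prod_ne_zero_iff.2 fun w hw => pow_ne_zero _ (sub_ne_zero.2 ?_)
        rintro rfl; exact hz hw
      have : f = (fun s : ℂ => ∏ z ∈ Z, (s - z) ^ analyticOrderNatAt f z) * h := by
        funext s; exact hfac s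
      have h2 : analyticOrderAt f z = analyticOrderAt h z := by
        conv_lhs => rw [this]
        rw [analyticOrderAt_mul hP (hd.analyticAt z), hP0, zero_add]
      simp [analyticOrderNatAt, h2]
    refine ⟨k, kd, fun s => ?_, ?_⟩
    · rw [Finset.prod_insert hz, hfac, kfac s, hord]; ring
    · intro w hw
      rcases Finset.mem_insert.1 hw with rfl | hw
      · exact knz
      · intro h0
        apply hnz w hw
        rw [kfac, h0, mul_zero]

/-- The Borel–Carathéodory estimate for the variation of a logarithmic derivative. -/
theorem norm_logDeriv_sub_logDeriv_zero_le {h : ℂ → ℂ} {r M : ℝ} (hr : 0 < r) (hM : 0 < M)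
    (hd : Differentiable ℂ h) (h0 : ∀ s ∈ Metric.ball (0 : ℂ) r, h s ≠ 0)
    (hb : ∀ s ∈ Metric.ball (0 : ℂ) r, ‖h s‖ ≤ ‖h 0‖ * Real.exp M) {s : ℂ} (hs : ‖s‖ ≤ r / 8) :
    ‖logDeriv h s - logDeriv h 0‖ ≤ 128 * M / r ^ 2 * ‖s‖ := by
  have hm0 : (0 : ℂ) ∈ Metric.ball (0 : ℂ) r := by simpa using hr
  have hqd : DifferentiableOn ℂ (logDeriv h) (Metric.ball 0 r) := by
    have : DifferentiableOn ℂ (deriv h) (Metric.ball 0 r) :=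
      hd.differentiableOn.deriv Metric.isOpen_ball
    exact this.div hd.differentiableOn h0
  obtain ⟨G, hG0, hG⟩ := hqd.isExactOn_ball.with_val_at 0 0
  have hGd : DifferentiableOn ℂ G (Metric.ball 0 r) := fun z hz =>
    (hG z hz).differentiableAt.differentiableWithinAt
  have hexp : ∀ z ∈ Metric.ball (0 : ℂ) r, h z = h 0 * Complex.exp (G z) := by
    have hc : ∀ z ∈ Metric.ball (0 : ℂ) r, h z * Complex.exp (-G z) = h 0 * Complex.exp (-G 0) := by
      intro z hz
      refine (convex_ball (0 : ℂ) r).is_const_of_fderivWithin_eq_zero (𝕜 := ℂ)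
        (f := fun z => h z * Complex.exp (-G z)) ?_ ?_ hz hm0
      · exact hd.differentiableOn.mul (hGd.neg.cexp)
      · intro w hw
        have h1 : HasDerivAt (fun z => h z * Complex.exp (-G z)) 0 w := by
          refine ((hd w).hasDerivAt.mul ((hG w hw).neg.cexp)).congr_deriv ?_
          rw [logDeriv_apply]
          have := h0 w hw
          field_simp
          ring
        rw [fderivWithin_of_isOpen Metric.isOpen_ball hw]
        simpa using h1.hasFDerivAt.fderiv
    intro z hz
    have := hc z hz
    rw [hG0, neg_zero, Complex.exp_zero, mul_one, Complex.exp_neg] at this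
    rw [← this]
    field_simp [Complex.exp_ne_zero]
  have hre : Set.MapsTo G (Metric.ball 0 r) {z | z.re ≤ M} := by
    intro z hz
    have h1 := hb z hz
    rw [hexp z hz, norm_mul, Complex.norm_exp] at h1
    exact Real.exp_le_exp.1 (le_of_mul_le_mul_left h1 (norm_pos_iff.2 (h0 0 hm0)))
  have hGb : ∀ z : ℂ, ‖z‖ ≤ r / 2 → ‖G z‖ ≤ 2 * M := by
    intro z hz
    have := Complex.borelCaratheodory_zero hM hGd hre hr
      (by simp only [Metric.mem_ball, dist_zero_right]; linarith) hG0
    refine this.trans ?_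
    rw [div_le_iff₀ (by linarith)]
    nlinarith
  have hsub : ∀ {c : ℂ} {a ρ : ℝ}, ‖c‖ + ρ ≤ a → a < r →
      Metric.closedBall c ρ ⊆ Metric.ball 0 r := by
    intro c a ρ h1 h2
    exact (Metric.closedBall_subset_closedBall' (by simpa [add_comm] using h1)).trans
      (Metric.closedBall_subset_ball h2)
  have hq1 : ∀ z : ℂ, ‖z‖ ≤ r / 4 → ‖logDeriv h z‖ ≤ 8 * M / r := by
    intro z hz
    have hb := Complex.norm_deriv_le_of_forall_mem_sphere_norm_le (c := z) (R := r / 4) (C := 2 * M)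
      (f := G) (by linarith) ?_ ?_
    · rw [(hG z (by simp only [Metric.mem_ball, dist_zero_right]; linarith)).deriv] at hb
      refine hb.trans (le_of_eq ?_)
      field_simp; norm_num
    · refine (hGd.mono ?_).diffContOnCl
      exact (Metric.closure_ball_subset_closedBall).trans (hsub (a := r / 2) (by linarith) (by linarith))
    · intro w hw
      apply hGb
      have h1 : ‖w‖ ≤ ‖w - z‖ + ‖z‖ := by simpa using norm_add_le (w - z) z
      have h2 : ‖w - z‖ = r / 4 := by simpa [dist_eq_norm] using hw
      linarith
  have hq2 : ∀ z ∈ Metric.closedBall (0 : ℂ) (r / 8), ‖deriv (logDeriv h) z‖ ≤ 128 * M / r ^ 2 := by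
    intro z hz
    have hz' : ‖z‖ ≤ r / 8 := by simpa using hz
    have hb := Complex.norm_deriv_le_of_forall_mem_sphere_norm_le (c := z) (R := r / 8)
      (C := 8 * M / r) (f := logDeriv h) (by linarith) ?_ ?_
    · refine hb.trans ?_
      have : 8 * M / r / (r / 8) = 64 * M / r ^ 2 := by field_simp; norm_num
      rw [this]
      gcongr
      norm_num
    · refine (hqd.mono ?_).diffContOnCl
      exact (Metric.closure_ball_subset_closedBall).trans (hsub (a := r / 2) (by linarith) (by linarith))
    · intro w hw
      apply hq1
      have h1 : ‖w‖ ≤ ‖w - z‖ + ‖z‖ := by simpa using norm_add_le (w - z) z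
      have h2 : ‖w - z‖ = r / 8 := by simpa [dist_eq_norm] using hw
      linarith
  have := (convex_closedBall (0 : ℂ) (r / 8)).norm_image_sub_le_of_norm_deriv_le (𝕜 := ℂ)
    (f := logDeriv h) (x := 0) (y := s) (fun z hz => ?_) hq2 (by simp; linarith) (by simpa using hs)
  · simpa using this
  · refine (hqd z ?_).differentiableAt (Metric.isOpen_ball.mem_nhds ?_) <;>
    · simp only [Metric.mem_closedBall, Metric.mem_ball, dist_zero_right] at hz ⊢
      linarith

/-- The zeros of an entire function in a closed disc about the origin. -/
noncomputable def zerosIn (f : ℂ → ℂ) (r : ℝ) : Finset ℂ :=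
  open Classical in
  if h : (Metric.closedBall (0 : ℂ) r ∩ f ⁻¹' {0}).Finite then h.toFinset else ∅

theorem Differentiable.mem_zerosIn {f : ℂ → ℂ} (hf : Differentiable ℂ f) (h0 : f 0 ≠ 0) {r : ℝ}
    {z : ℂ} : z ∈ zerosIn f r ↔ ‖z‖ ≤ r ∧ f z = 0 := by
  have hfin : (Metric.closedBall (0 : ℂ) r ∩ f ⁻¹' {0}).Finite := by
    by_contra hinf
    obtain ⟨w, -, hw⟩ := Set.Infinite.exists_accPt_of_subset_isCompact hinf
      (isCompact_closedBall (0 : ℂ) r) Set.inter_subset_left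
    have hA : AnalyticOnNhd ℂ f Set.univ := fun s _ => hf.analyticAt s
    apply h0
    refine hA.eqOn_zero_of_preconnected_of_frequently_eq_zero isPreconnected_univ
      (Set.mem_univ w) ?_ (Set.mem_univ 0)
    rw [accPt_iff_frequently_nhdsNE] at hw
    exact hw.mono fun z hz => hz.2
  simp [zerosIn, hfin]

/-- A truncated form of the Hadamard partial fraction expansion. -/
theorem Differentiable.exists_norm_sub_sum_zerosIn_le {f : ℂ → ℂ} (hf : Differentiable ℂ f)
    (h0 : f 0 ≠ 0) {r M : ℝ} (hr : 0 < r) (hM : 0 < M)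
    (hb : ∀ w : ℂ, ‖w‖ = 2 * r → ‖f w‖ ≤ ‖f 0‖ * Real.exp M) {s : ℂ} (hs : ‖s‖ ≤ r / 8)
    (hfs : f s ≠ 0) :
    ‖(logDeriv f s - logDeriv f 0) -
      ∑ z ∈ zerosIn f r, (analyticOrderNatAt f z : ℂ) * (1 / (s - z) + 1 / z)‖ ≤
      128 * M / r ^ 2 * ‖s‖ := by
  set Z := zerosIn f r with hZ
  have hmem : ∀ z, z ∈ Z ↔ ‖z‖ ≤ r ∧ f z = 0 := fun z => hf.mem_zerosIn h0
  obtain ⟨h, hd, hfac, hnz⟩ := hf.exists_eq_prod_pow_mul ⟨0, h0⟩ Z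
  set P : ℂ → ℂ := fun s => ∏ z ∈ Z, (s - z) ^ analyticOrderNatAt f z with hP
  have hlog : ∀ w, f w ≠ 0 → logDeriv f w =
      ∑ z ∈ Z, (analyticOrderNatAt f z : ℂ) * (1 / (w - z)) + logDeriv h w := by
    intro w hw
    have hwz : ∀ z ∈ Z, w - z ≠ 0 := by
      intro z hz h
      rw [sub_eq_zero] at h
      exact hw (h ▸ ((hmem z).1 hz).2)
    have hfe : f = fun s => P s * h s := funext hfac
    have hPw : P w ≠ 0 := Finset.prod_ne_zero_iff.2 fun z hz => pow_ne_zero _ (hwz z hz)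
    have hhw : h w ≠ 0 := fun h' => hw (by rw [hfac, h', mul_zero])
    conv_lhs => rw [hfe]
    rw [logDeriv_mul _ hPw hhw (by fun_prop) (hd w)]
    congr 1
    rw [hP, logDeriv_prod]
    · refine Finset.sum_congr rfl fun z hz => ?_
      rw [logDeriv_fun_pow (by fun_prop)]
      simp [logDeriv_apply]
    · exact fun z hz => pow_ne_zero _ (hwz z hz)
    · intro z hz; fun_prop
  have hP0 : P 0 ≠ 0 := fun h' => h0 (by rw [hfac]; simp only [hP] at h'; rw [h', zero_mul])
  have hfr : ∀ w : ℂ, ‖w‖ = 2 * r → ‖h w‖ ≤ ‖h 0‖ * Real.exp M := by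
    intro w hw
    have hPw : ‖P 0‖ ≤ ‖P w‖ := by
      simp only [hP, norm_prod, norm_pow]
      refine Finset.prod_le_prod (fun _ _ => by positivity) fun z hz => ?_
      gcongr
      have h1 := ((hmem z).1 hz).1
      have h2 := norm_sub_norm_le w z
      rw [zero_sub, norm_neg]
      linarith
    have h1 := hb w hw
    rw [hfac w, hfac 0, norm_mul, norm_mul] at h1
    have hpos : 0 < ‖P 0‖ := norm_pos_iff.2 hP0
    have h2 : ‖P 0‖ * ‖h w‖ ≤ ‖P 0‖ * (‖h 0‖ * Real.exp M) := by
      calc ‖P 0‖ * ‖h w‖ ≤ ‖P w‖ * ‖h w‖ := by gcongr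
        _ ≤ ‖P 0‖ * ‖h 0‖ * Real.exp M := h1
        _ = _ := by ring
    exact le_of_mul_le_mul_left h2 hpos
  have hin : ∀ w ∈ Metric.ball (0 : ℂ) r, ‖h w‖ ≤ ‖h 0‖ * Real.exp M := by
    intro w hw
    refine Complex.norm_le_of_forall_mem_frontier_norm_le (U := Metric.ball (0 : ℂ) (2 * r))
      Metric.isBounded_ball hd.diffContOnCl ?_
      (subset_closure (Metric.ball_subset_ball (by linarith) hw))
    intro v hv
    rw [frontier_ball _ (by linarith)] at hv
    exact hfr v (by simpa using hv)
  have hh0 : ∀ w ∈ Metric.ball (0 : ℂ) r, h w ≠ 0 := by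
    intro w hw h'
    have hfw : f w = 0 := by rw [hfac, h', mul_zero]
    refine hnz w ((hmem w).2 ⟨?_, hfw⟩) h'
    exact (mem_ball_zero_iff.1 hw).le
  refine le_trans (le_of_eq ?_) (norm_logDeriv_sub_logDeriv_zero_le hr hM hd hh0 hin hs)
  congr 1
  rw [hlog s hfs, hlog 0 h0]
  simp only [mul_add, Finset.sum_add_distrib]
  have : ∑ z ∈ Z, (analyticOrderNatAt f z : ℂ) * (1 / (0 - z)) =
      - ∑ z ∈ Z, (analyticOrderNatAt f z : ℂ) * (1 / z) := by
    rw [← Finset.sum_neg_distrib]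
    refine Finset.sum_congr rfl fun z _ => ?_
    rw [zero_sub, div_neg, mul_neg]
  rw [this]
  ring

theorem Differentiable.tendsto_sum_zerosIn {f : ℂ → ℂ} (hf : Differentiable ℂ f)
    (h0 : f 0 ≠ 0) {A : ℝ} {R : ℝ}
    (hb : ∀ w : ℂ, R ≤ ‖w‖ → ‖f w‖ ≤ Real.exp (A * ‖w‖ ^ (3 / 2 : ℝ))) {s : ℂ} (hfs : f s ≠ 0) :
    Tendsto (fun r : ℝ =>
      ∑ z ∈ zerosIn f r, (analyticOrderNatAt f z : ℂ) * (1 / (s - z) + 1 / z)) atTop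
      (𝓝 (logDeriv f s - logDeriv f 0)) := by
  rw [← tendsto_sub_nhds_zero_iff, tendsto_zero_iff_norm_tendsto_zero]
  set B := |Real.log ‖f 0‖| + 1
  have hlim : Tendsto (fun r : ℝ => 128 * (|A| * (2 * r) ^ (3 / 2 : ℝ) + B) / r ^ 2 * ‖s‖)
      atTop (𝓝 0) := by
    have h1 : Tendsto (fun r : ℝ => (128 * |A| * 2 ^ (3 / 2 : ℝ) * ‖s‖) * r ^ (-(1 / 2) : ℝ) +
        (128 * B * ‖s‖) * r ^ (-2 : ℝ)) atTop (𝓝 0) := by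
      have := ((tendsto_rpow_neg_atTop (y := 1 / 2) (by norm_num)).const_mul
        (128 * |A| * 2 ^ (3 / 2 : ℝ) * ‖s‖)).add
        ((tendsto_rpow_neg_atTop (y := 2) (by norm_num)).const_mul (128 * B * ‖s‖))
      simpa using this
    refine h1.congr' ?_
    filter_upwards [eventually_gt_atTop 0] with r hr
    have e1 : r ^ (-(1 / 2) : ℝ) = r ^ (3 / 2 : ℝ) / r ^ 2 := by
      rw [← Real.rpow_natCast, ← Real.rpow_sub hr]; norm_num
    have e2 : r ^ (-2 : ℝ) = 1 / r ^ 2 := by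
      rw [← Real.rpow_natCast, Real.rpow_neg hr.le, one_div]; norm_num
    rw [e1, e2, Real.mul_rpow (by norm_num) hr.le]
    field_simp
  refine squeeze_zero' (Eventually.of_forall fun _ => norm_nonneg _) ?_ hlim
  filter_upwards [eventually_gt_atTop 0, eventually_ge_atTop R, eventually_ge_atTop (8 * ‖s‖)]
    with r hr hR hs
  rw [norm_sub_rev]
  refine hf.exists_norm_sub_sum_zerosIn_le h0 hr (by positivity) ?_ (by linarith) hfs
  intro w hw
  have hpos : 0 < ‖f 0‖ := norm_pos_iff.2 h0
  calc ‖f w‖ ≤ Real.exp (A * ‖w‖ ^ (3 / 2 : ℝ)) := hb w (by linarith)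
    _ ≤ Real.exp (Real.log ‖f 0‖ + (|A| * (2 * r) ^ (3 / 2 : ℝ) + B)) := by
      rw [hw]
      gcongr
      have h1 : A * (2 * r) ^ (3 / 2 : ℝ) ≤ |A| * (2 * r) ^ (3 / 2 : ℝ) := by
        gcongr; exact le_abs_self A
      have h2 := neg_abs_le (Real.log ‖f 0‖)
      linarith
    _ = _ := by rw [Real.exp_add, Real.exp_log hpos]

/-- The fractional part on `(1, ∞)`, extended by zero. -/
noncomputable def fractTail (t : ℝ) : ℂ :=
  (Ioi (1 : ℝ)).indicator (fun t => ((Int.fract t : ℝ) : ℂ)) t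

theorem mellin_fractTail (s : ℂ) :
    mellin fractTail s = ∫ t in Ioi (1 : ℝ), (t : ℂ) ^ (s - 1) * ((Int.fract t : ℝ) : ℂ) := by
  have : (fun t : ℝ => (t : ℂ) ^ (s - 1) • fractTail t) =
      (Ioi (1 : ℝ)).indicator (fun t => (t : ℂ) ^ (s - 1) * ((Int.fract t : ℝ) : ℂ)) := by
    funext t
    by_cases ht : t ∈ Ioi (1 : ℝ) <;> simp [fractTail, ht]
  rw [mellin, this, setIntegral_indicator measurableSet_Ioi]
  congr 2
  ext t
  simp only [mem_inter_iff, mem_Ioi]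
  constructor
  · exact fun h => h.2
  · exact fun h => ⟨by linarith, h⟩

theorem norm_fractTail_le (t : ℝ) : ‖fractTail t‖ ≤ 1 := by
  by_cases ht : t ∈ Ioi (1 : ℝ)
  · simp [fractTail, ht, abs_of_nonneg (Int.fract_nonneg t), (Int.fract_lt_one t).le]
  · simp [fractTail, ht]

theorem measurable_fractTail : Measurable fractTail :=
  (Complex.measurable_ofReal.comp measurable_fract).indicator measurableSet_Ioi

theorem differentiableAt_mellin_fractTail {s : ℂ} (hs : s.re < 0) :
    DifferentiableAt ℂ (mellin fractTail) s := by
  refine mellin_differentiableAt_of_isBigO_rpow (a := 0) (b := s.re - 1) ?_ ?_ (by simpa) ?_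
    (by linarith)
  · refine MeasureTheory.LocallyIntegrable.locallyIntegrableOn ?_ _
    refine (locallyIntegrable_const (1 : ℝ)).mono measurable_fractTail.aestronglyMeasurable ?_
    exact Eventually.of_forall fun t => by simpa using norm_fractTail_le t
  · simp only [neg_zero, Real.rpow_zero]
    exact Asymptotics.isBigO_of_le _ fun t => by simpa using norm_fractTail_le t
  · refine (Asymptotics.isBigO_zero _ _).congr' ?_ (EventuallyEq.refl _ _)
    filter_upwards [mem_nhdsWithin_of_mem_nhds (Iio_mem_nhds (show (0 : ℝ) < 1 by norm_num))]
      with t ht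
    have : ¬ (1 < t) := not_lt.2 (le_of_lt ht)
    simp [fractTail, this]

theorem norm_mellin_fractTail_le {s : ℂ} (hs : s.re ≤ -(1 / 2)) :
    ‖mellin fractTail s‖ ≤ 2 := by
  rw [mellin_fractTail]
  have h1 : IntegrableOn (fun t : ℝ => t ^ (-(3 / 2) : ℝ)) (Ioi 1) :=
    integrableOn_Ioi_rpow_of_lt (by norm_num) (by norm_num)
  refine (norm_integral_le_of_norm_le h1 ?_).trans ?_
  · refine (ae_restrict_iff' measurableSet_Ioi).2 (Eventually.of_forall fun t ht => ?_)
    have ht1 : (1 : ℝ) < t := ht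
    rw [norm_mul, Complex.norm_cpow_eq_rpow_re_of_pos (by linarith)]
    simp only [Complex.norm_real, Real.norm_eq_abs, abs_of_nonneg (Int.fract_nonneg t)]
    calc t ^ (s - 1).re * Int.fract t ≤ t ^ (s - 1).re * 1 := by
          gcongr
          exact (Int.fract_lt_one t).le
      _ ≤ t ^ (-(3 / 2) : ℝ) := by
          rw [mul_one]
          apply Real.rpow_le_rpow_of_exponent_le ht1.le
          simp only [Complex.sub_re, Complex.one_re]
          linarith
  · rw [integral_Ioi_rpow_of_lt (by norm_num) (by norm_num)]
    norm_num

theorem riemannZeta_eq_of_one_lt_re {s : ℂ} (hs : 1 < s.re) :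
    riemannZeta s = s / (s - 1) - s * mellin fractTail (-s) := by
  have h1 : LSeries 1 s = s * ∫ t in Ioi (1 : ℝ), (∑ k ∈ Finset.Icc 1 ⌊t⌋₊, (1 : ℕ → ℂ) k) *
      (t : ℂ) ^ (-(s + 1)) := by
    refine LSeries_eq_mul_integral 1 zero_le_one hs (LSeriesSummable_one_iff.2 hs) ?_
    refine Asymptotics.isBigO_of_le _ fun n => ?_
    simp
  rw [← LSeries_one_eq_riemannZeta hs, h1, mellin_fractTail]
  have i1 : IntegrableOn (fun t : ℝ => (t : ℂ) ^ (-s)) (Ioi 1) :=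
    integrableOn_Ioi_cpow_of_lt (by simpa using hs) zero_lt_one
  have i2 : IntegrableOn (fun t : ℝ => (t : ℂ) ^ (-s - 1) * ((Int.fract t : ℝ) : ℂ)) (Ioi 1) := by
    have i3 : IntegrableOn (fun t : ℝ => (t : ℂ) ^ (-s - 1)) (Ioi 1) :=
      integrableOn_Ioi_cpow_of_lt (by simp; linarith) zero_lt_one
    refine i3.mul_bdd (c := 1) ?_ ?_
    · exact (Complex.measurable_ofReal.comp measurable_fract).aestronglyMeasurable
    · exact Eventually.of_forall fun t => by
        simp [abs_of_nonneg (Int.fract_nonneg t), (Int.fract_lt_one t).le]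
  have e : ∫ t in Ioi (1 : ℝ), (∑ k ∈ Finset.Icc 1 ⌊t⌋₊, (1 : ℕ → ℂ) k) *
      (t : ℂ) ^ (-(s + 1)) = ∫ t in Ioi (1 : ℝ), ((t : ℂ) ^ (-s) -
        (t : ℂ) ^ (-s - 1) * ((Int.fract t : ℝ) : ℂ)) := by
    refine setIntegral_congr_fun measurableSet_Ioi fun t ht => ?_
    have ht1 : (1 : ℝ) < t := ht
    have ht0 : (t : ℂ) ≠ 0 := by exact_mod_cast (by linarith : t ≠ 0)
    have hfl : ((⌊t⌋₊ : ℕ) : ℂ) = (t : ℂ) - ((Int.fract t : ℝ) : ℂ) := by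
      have : ((⌊t⌋₊ : ℕ) : ℝ) = t - Int.fract t := by
        rw [natCast_floor_eq_intCast_floor (by linarith)]
        have := Int.self_sub_fract t
        linarith
      exact_mod_cast this
    have hp : (t : ℂ) ^ (-s) = (t : ℂ) ^ (-s - 1) * t := by
      rw [Complex.cpow_sub _ _ ht0, Complex.cpow_one]; field_simp
    simp only [Pi.one_apply, Finset.sum_const, Nat.card_Icc, add_tsub_cancel_right, nsmul_eq_mul,
      mul_one]
    rw [hfl, hp, show -(s + 1) = -s - 1 by ring]
    ring
  rw [e, integral_sub i1 i2, integral_Ioi_cpow_of_lt (by simpa using hs) zero_lt_one]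
  have : s - 1 ≠ 0 := by
    intro h
    have := congrArg Complex.re h
    simp at this; linarith
  have h' : -s + 1 ≠ 0 := by
    intro h; apply this; linear_combination -h
  simp only [Complex.ofReal_one, Complex.one_cpow]
  rw [mul_sub]
  congr 1
  field_simp
  ring

theorem riemannZeta₁_eq_of_re_pos {s : ℂ} (hs : 0 < s.re) :
    riemannZeta₁ s = s - s * (s - 1) * mellin fractTail (-s) := by
  have hU : IsOpen {s : ℂ | 0 < s.re} := isOpen_lt continuous_const Complex.continuous_re
  have hconn : IsPreconnected {s : ℂ | 0 < s.re} := (convex_halfSpace_re_gt 0).isPreconnected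
  have hA1 : AnalyticOnNhd ℂ riemannZeta₁ {s : ℂ | 0 < s.re} :=
    fun z _ => differentiable_riemannZeta₁.analyticAt z
  have hA2 : AnalyticOnNhd ℂ (fun s => s - s * (s - 1) * mellin fractTail (-s))
      {s : ℂ | 0 < s.re} := by
    refine DifferentiableOn.analyticOnNhd (fun z hz => ?_) hU
    have h1 : DifferentiableAt ℂ (fun s => mellin fractTail (-s)) z :=
      DifferentiableAt.fun_comp' (g := mellin fractTail) (f := fun s => -s) z
        (differentiableAt_mellin_fractTail (by simpa using hz)) differentiableAt_id.neg
    exact DifferentiableAt.differentiableWithinAt (by fun_prop)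
  refine hA1.eqOn_of_preconnected_of_eventuallyEq hA2 hconn (z₀ := 2) (by simp) ?_ hs
  have : {s : ℂ | 1 < s.re} ∈ 𝓝 (2 : ℂ) :=
    (isOpen_lt continuous_const Complex.continuous_re).mem_nhds (by simp)
  filter_upwards [this] with z hz
  have hz1 : z ≠ 1 := by rintro rfl; simp at hz
  have hz2 : z - 1 ≠ 0 := sub_ne_zero.2 hz1
  have h1 := riemannZeta_eq_of_one_lt_re hz
  rw [riemannZeta_eq_inv_sub_mul hz1] at h1
  field_simp at h1
  rw [h1]; ring

theorem norm_riemannZeta₁_le {s : ℂ} (hs : 1 / 2 ≤ s.re) :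
    ‖riemannZeta₁ s‖ ≤ ‖s‖ + 2 * (‖s‖ * ‖s - 1‖) := by
  rw [riemannZeta₁_eq_of_re_pos (by linarith)]
  refine (norm_sub_le _ _).trans ?_
  rw [norm_mul, norm_mul]
  have := norm_mellin_fractTail_le (s := -s) (by simp only [Complex.neg_re]; linarith)
  nlinarith [mul_nonneg (norm_nonneg s) (norm_nonneg (s - 1))]

theorem norm_Gamma_le_Gamma_re {s : ℂ} (hs : 0 < s.re) : ‖Complex.Gamma s‖ ≤ Real.Gamma s.re := by
  rw [Complex.Gamma_eq_integral hs, Real.Gamma_eq_integral hs, Complex.GammaIntegral]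
  refine (norm_integral_le_integral_norm _).trans (le_of_eq ?_)
  refine setIntegral_congr_fun measurableSet_Ioi fun t ht => ?_
  have ht0 : (0 : ℝ) < t := ht
  simp only [norm_mul, Complex.norm_real, Real.norm_eq_abs, Real.abs_exp]
  rw [Complex.norm_cpow_eq_rpow_re_of_pos ht0]
  simp

theorem Gamma_le_exp_rpow {x R : ℝ} (hx : 1 / 2 ≤ x) (hR : 2 ≤ R) (hxR : x ≤ R + 1) :
    Real.Gamma x ≤ 4 / 3 * Real.exp (12 * R ^ (3 / 2 : ℝ)) := by
  have hx0 : 0 < x := by linarith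
  have h1 : Real.Gamma (x + 2) = (x + 1) * (x * Real.Gamma x) := by
    rw [show x + 2 = (x + 1) + 1 by ring, Real.Gamma_add_one (by linarith),
      Real.Gamma_add_one hx0.ne']
  set N := ⌈x⌉₊ + 1 with hN
  have hxN : x + 1 ≤ N := by
    have := Nat.le_ceil x
    rw [hN]; push_cast; linarith
  have hNx : (N : ℝ) ≤ 3 * R := by
    have := Nat.ceil_lt_add_one hx0.le
    rw [hN]; push_cast; linarith
  have hN0 : (0 : ℝ) < N := by linarith
  have h2 : Real.Gamma (x + 2) ≤ Real.Gamma (N + 1) :=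
    Real.Gamma_strictMonoOn_Ici.monotoneOn (by simp only [mem_Ici]; linarith)
      (by simp only [mem_Ici]; linarith) (by linarith)
  rw [Real.Gamma_nat_eq_factorial] at h2
  have h3 : (N.factorial : ℝ) ≤ (N : ℝ) ^ N := by exact_mod_cast N.factorial_le_pow
  have h4 : (N : ℝ) ^ N ≤ Real.exp (12 * R ^ (3 / 2 : ℝ)) := by
    have e : (N : ℝ) ^ N = Real.exp (N * Real.log N) := by rw [Real.exp_nat_mul, Real.exp_log hN0]
    rw [e]
    apply Real.exp_le_exp.2
    have h5 : Real.log N ≤ (N : ℝ) ^ (1 / 2 : ℝ) / (1 / 2) :=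
      Real.log_le_rpow_div hN0.le (by norm_num)
    have h6 : (3 : ℝ) ^ (3 / 2 : ℝ) ≤ 6 := by
      rw [show (3 / 2 : ℝ) = 1 + 1 / 2 by norm_num, Real.rpow_add (by norm_num), Real.rpow_one,
        ← Real.sqrt_eq_rpow]
      have : Real.sqrt 3 ≤ 2 := Real.sqrt_le_iff.2 (by norm_num)
      linarith
    calc (N : ℝ) * Real.log N ≤ N * ((N : ℝ) ^ (1 / 2 : ℝ) / (1 / 2)) := by gcongr
      _ = 2 * (N : ℝ) ^ (3 / 2 : ℝ) := by
        rw [show (3 / 2 : ℝ) = 1 + 1 / 2 by norm_num, Real.rpow_add hN0, Real.rpow_one]; ring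
      _ ≤ 2 * (3 * R) ^ (3 / 2 : ℝ) := by gcongr
      _ = 2 * (3 ^ (3 / 2 : ℝ) * R ^ (3 / 2 : ℝ)) := by
        rw [Real.mul_rpow (by norm_num) (by linarith)]
      _ ≤ 2 * (6 * R ^ (3 / 2 : ℝ)) := by gcongr
      _ = _ := by ring
  have hG : 0 < Real.Gamma x := Real.Gamma_pos_of_pos hx0
  have h7 : 3 / 4 ≤ (x + 1) * x := by nlinarith
  have h8 := mul_le_mul_of_nonneg_right h7 hG.le
  rw [h1, ← mul_assoc] at h2
  linarith

theorem norm_cos_le_exp (z : ℂ) : ‖Complex.cos z‖ ≤ Real.exp ‖z‖ := by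
  rw [Complex.cos, norm_div]
  have h1 : ‖Complex.exp (z * Complex.I)‖ ≤ Real.exp ‖z‖ := by
    rw [Complex.norm_exp]
    exact Real.exp_le_exp.2 ((Complex.re_le_norm _).trans (by simp))
  have h2 : ‖Complex.exp (-z * Complex.I)‖ ≤ Real.exp ‖z‖ := by
    rw [Complex.norm_exp]
    exact Real.exp_le_exp.2 ((Complex.re_le_norm _).trans (by simp))
  have := norm_add_le (Complex.exp (z * Complex.I)) (Complex.exp (-z * Complex.I))
  rw [Complex.norm_ofNat]
  linarith

theorem riemannZeta₁_eq_sub_mul {s : ℂ} (hs : s ≠ 1) :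
    riemannZeta₁ s = (s - 1) * riemannZeta s := by
  have : s - 1 ≠ 0 := sub_ne_zero.2 hs
  rw [riemannZeta_eq_inv_sub_mul hs]; field_simp

theorem riemannZeta₁_one_sub {u : ℂ} (hu : 0 < u.re) (hu1 : u ≠ 1) :
    riemannZeta₁ (1 - u) = -u * (2 * (2 * π) ^ (-u) * Complex.Gamma u * Complex.cos (π * u / 2) *
      riemannZeta u) := by
  have h0 : u ≠ 0 := by rintro rfl; simp at hu
  rw [riemannZeta₁_eq_sub_mul (by intro h; apply h0; linear_combination -h),
    riemannZeta_one_sub _ hu1]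
  · ring
  · rintro n rfl
    simp at hu
    have : (0 : ℝ) ≤ n := n.cast_nonneg
    linarith

theorem norm_riemannZeta₁_le_exp {s : ℂ} (hs : 2 ≤ ‖s‖) :
    ‖riemannZeta₁ s‖ ≤ Real.exp (22 * ‖s‖ ^ (3 / 2 : ℝ)) := by
  set R := ‖s‖ with hR
  have hRR : R ≤ R ^ (3 / 2 : ℝ) := by
    conv_lhs => rw [← Real.rpow_one R]
    exact Real.rpow_le_rpow_of_exponent_le (by linarith) (by norm_num)
  have hexp1 : 6 * R ^ 2 ≤ Real.exp (3 * R) := by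
    have h1 : R + 1 ≤ Real.exp R := Real.add_one_le_exp R
    have h2 : Real.exp (3 * R) = Real.exp R ^ 3 := by
      rw [← Real.exp_nat_mul]; norm_num
    rw [h2]
    have h3 : (R + 1) ^ 3 ≤ Real.exp R ^ 3 := by gcongr
    nlinarith [pow_pos (show 0 < R - 1 by linarith) 3]
  have hs1 : ‖s - 1‖ ≤ R + 1 := by simpa using norm_sub_le s 1
  rcases le_or_gt (1 / 2) s.re with h | h
  · have h1 := norm_riemannZeta₁_le h
    calc ‖riemannZeta₁ s‖ ≤ 6 * R ^ 2 := by nlinarith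
      _ ≤ Real.exp (3 * R) := hexp1
      _ ≤ _ := Real.exp_le_exp.2 (by linarith)
  · obtain ⟨u, rfl⟩ : ∃ u, s = 1 - u := ⟨1 - s, by ring⟩
    have hu : 1 / 2 ≤ u.re := by simp at h; linarith
    have huR : ‖u‖ ≤ R + 1 := by
      rw [show ‖u‖ = ‖1 - u - 1‖ by rw [show 1 - u - 1 = -u by ring, norm_neg]]; exact hs1
    have hu1' : ‖u - 1‖ = R := by rw [hR, norm_sub_rev]
    have hu1 : u ≠ 1 := by rintro rfl; simp at hu1'; linarith
    rw [riemannZeta₁_one_sub (by linarith) hu1]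
    have hz : ‖riemannZeta u‖ ≤ 6 * R ^ 2 := by
      rw [riemannZeta_eq_inv_sub_mul hu1, norm_mul, norm_inv, hu1']
      have h1 := norm_riemannZeta₁_le hu
      rw [hu1'] at h1
      have h2 : R⁻¹ ≤ 1 := inv_le_one_of_one_le₀ (by linarith)
      calc R⁻¹ * ‖riemannZeta₁ u‖ ≤ 1 * (‖u‖ + 2 * (‖u‖ * R)) := by gcongr
        _ ≤ 6 * R ^ 2 := by nlinarith
    have hp : ‖(2 * π : ℂ) ^ (-u)‖ ≤ 1 := by
      rw [show (2 * π : ℂ) = ((2 * π : ℝ) : ℂ) by push_cast; ring,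
        Complex.norm_cpow_eq_rpow_re_of_pos (by positivity)]
      apply Real.rpow_le_one_of_one_le_of_nonpos
      · linarith [Real.pi_gt_three]
      · simp only [Complex.neg_re]; linarith
    have hg : ‖Complex.Gamma u‖ ≤ 4 / 3 * Real.exp (12 * R ^ (3 / 2 : ℝ)) :=
      (norm_Gamma_le_Gamma_re (by linarith)).trans
        (Gamma_le_exp_rpow hu hs ((Complex.re_le_norm u).trans huR))
    have hc : ‖Complex.cos (π * u / 2)‖ ≤ Real.exp (3 * R) := by
      refine (norm_cos_le_exp _).trans (Real.exp_le_exp.2 ?_)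
      rw [norm_div, norm_mul, Complex.norm_real, Real.norm_eq_abs, abs_of_pos Real.pi_pos,
        Complex.norm_ofNat]
      have := Real.pi_le_four
      nlinarith [norm_nonneg u]
    rw [norm_mul, norm_mul, norm_mul, norm_mul, norm_mul, norm_neg, Complex.norm_ofNat]
    calc ‖u‖ * (2 * ‖(2 * π : ℂ) ^ (-u)‖ * ‖Complex.Gamma u‖ * ‖Complex.cos (π * u / 2)‖ *
          ‖riemannZeta u‖)
        ≤ (R + 1) * (2 * 1 * (4 / 3 * Real.exp (12 * R ^ (3 / 2 : ℝ))) * Real.exp (3 * R) *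
          (6 * R ^ 2)) := by gcongr
      _ = (8 / 3 * (R + 1)) * (Real.exp (12 * R ^ (3 / 2 : ℝ)) * Real.exp (3 * R) *
          (6 * R ^ 2)) := by ring
      _ ≤ Real.exp (3 * R) * (Real.exp (12 * R ^ (3 / 2 : ℝ)) * Real.exp (3 * R) *
          Real.exp (3 * R)) := by
        gcongr
        nlinarith
      _ = Real.exp (12 * R ^ (3 / 2 : ℝ) + 9 * R) := by
        rw [← Real.exp_add, ← Real.exp_add, ← Real.exp_add]; ring_nf
      _ ≤ _ := Real.exp_le_exp.2 (by linarith)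

theorem riemannZeta₁_zero : riemannZeta₁ 0 = 1 / 2 := by
  rw [riemannZeta₁_eq_sub_mul (by norm_num), riemannZeta_zero]; norm_num

theorem logDeriv_riemannZeta₁_one : logDeriv riemannZeta₁ 1 = eulerMascheroniConstant := by
  simp [logDeriv_apply]

theorem hasDerivAt_riemannZeta₁ {s : ℂ} (hs : s ≠ 1) :
    HasDerivAt riemannZeta₁ (riemannZeta s + (s - 1) * deriv riemannZeta s) s := by
  have h1 : HasDerivAt (fun s => (s - 1) * riemannZeta s)
      (1 * riemannZeta s + (s - 1) * deriv riemannZeta s) s :=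
    ((hasDerivAt_id s).sub_const 1).mul (differentiableAt_riemannZeta hs).hasDerivAt
  rw [one_mul] at h1
  refine h1.congr_of_eventuallyEq ?_
  filter_upwards [isOpen_ne.mem_nhds hs] with v hv using riemannZeta₁_eq_sub_mul hv

theorem logDeriv_riemannZeta₁_zero :
    logDeriv riemannZeta₁ 0 = ((Real.log (2 * π) - 1 : ℝ) : ℂ) := by
  rw [logDeriv_apply, (hasDerivAt_riemannZeta₁ (s := 0) (by norm_num)).deriv, riemannZeta₁_zero,
    riemannZeta_zero, deriv_riemannZeta_zero]
  rw [show (2 * π : ℂ) = ((2 * π : ℝ) : ℂ) by push_cast; ring, ← Complex.ofReal_log (by positivity)]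
  push_cast
  ring

theorem logDeriv_riemannZeta₁ {s : ℂ} (hs : s ≠ 1) (h0 : riemannZeta s ≠ 0) :
    logDeriv riemannZeta₁ s = 1 / (s - 1) + deriv riemannZeta s / riemannZeta s := by
  have : s - 1 ≠ 0 := sub_ne_zero.2 hs
  rw [logDeriv_apply, (hasDerivAt_riemannZeta₁ hs).deriv, riemannZeta₁_eq_sub_mul hs]
  field_simp

theorem riemannZeta₁_eq_zero_imp (hRH : RiemannHypothesis) {z : ℂ} (hz : riemannZeta₁ z = 0) :
    (∃ n : ℕ, z = -2 * (n + 1)) ∨ z.re = 1 / 2 := by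
  have h1 : z ≠ 1 := by rintro rfl; simp at hz
  have hz' : riemannZeta z = 0 := by rw [riemannZeta_eq_inv_sub_mul h1, hz, mul_zero]
  by_cases h : ∃ n : ℕ, z = -2 * (n + 1)
  · exact Or.inl h
  · exact Or.inr (hRH z hz' h h1)

theorem riemannZeta₁_neg_two_mul (n : ℕ) : riemannZeta₁ (-2 * (n + 1)) = 0 := by
  rw [riemannZeta₁_eq_sub_mul, riemannZeta_neg_two_mul_nat_add_one, mul_zero]
  intro h
  have := congrArg Complex.re h
  simp at this
  have : (0 : ℝ) ≤ n := n.cast_nonneg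
  linarith

theorem analyticOrderNatAt_riemannZeta₁_neg_two_mul (n : ℕ) :
    analyticOrderNatAt riemannZeta₁ (-2 * (n + 1)) = 1 := by
  have hA := differentiable_riemannZeta₁.analyticAt (-2 * ((n : ℂ) + 1))
  have hder : deriv riemannZeta₁ (-2 * (n + 1)) ≠ 0 := by
    set u₀ : ℂ := 2 * n + 3 with hu₀
    have hure : u₀.re = 2 * n + 3 := by simp [hu₀]
    have hn : (0 : ℝ) ≤ n := n.cast_nonneg
    have hu1 : u₀ ≠ 1 := by intro h; rw [h] at hure; simp at hure; linarith
    have hu0 : u₀ ≠ 0 := by intro h; rw [h] at hure; simp at hure; linarith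
    have hnat : ∀ m : ℕ, u₀ ≠ -m := by
      intro m h
      rw [h] at hure; simp at hure
      have : (0 : ℝ) ≤ m := m.cast_nonneg
      linarith
    have hpi : (2 * π : ℂ) ≠ 0 := by simp [Real.pi_ne_zero]
    set K : ℂ → ℂ := fun u => -u * (2 * (2 * π) ^ (-u) * Complex.Gamma u * riemannZeta u)
    have hK : DifferentiableAt ℂ K u₀ := by
      have h1 := Complex.differentiableAt_Gamma u₀ hnat
      have h2 := differentiableAt_riemannZeta hu1
      have h3 : DifferentiableAt ℂ (fun u : ℂ => (2 * π : ℂ) ^ (-u)) u₀ :=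
        differentiableAt_id.neg.const_cpow (Or.inl hpi)
      fun_prop
    have hK0 : K u₀ ≠ 0 := by
      have h1 := riemannZeta_ne_zero_of_one_le_re (s := u₀) (by rw [hure]; linarith)
      have h2 := Complex.Gamma_ne_zero hnat
      have h3 : (2 * π : ℂ) ^ (-u₀) ≠ 0 := by simp [Complex.cpow_eq_zero_iff, Real.pi_ne_zero]
      simp only [K]
      simp [h1, h2, h3, hu0]
    have hcos : Complex.cos (π * u₀ / 2) = 0 := by
      rw [Complex.cos_eq_zero_iff]
      refine ⟨(n : ℤ) + 1, ?_⟩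
      rw [hu₀]; push_cast; ring
    have hsin : Complex.sin (π * u₀ / 2) ≠ 0 := by
      intro h
      have := Complex.sin_sq_add_cos_sq (π * u₀ / 2)
      rw [h, hcos] at this
      norm_num at this
    have hcd : HasDerivAt (fun u : ℂ => Complex.cos (π * u / 2))
        (-Complex.sin (π * u₀ / 2) * (π / 2)) u₀ := by
      have : HasDerivAt (fun u : ℂ => (π : ℂ) * u / 2) (π / 2) u₀ := by
        simpa using ((hasDerivAt_id u₀).const_mul (π : ℂ)).div_const 2
      exact this.ccos
    have h1 : HasDerivAt (fun u => riemannZeta₁ (1 - u))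
        (K u₀ * (-Complex.sin (π * u₀ / 2) * (π / 2))) u₀ := by
      have h2 := hK.hasDerivAt.mul hcd
      rw [hcos, mul_zero, zero_add] at h2
      refine h2.congr_of_eventuallyEq ?_
      have hU : {u : ℂ | 1 < u.re} ∈ 𝓝 u₀ :=
        (isOpen_lt continuous_const Complex.continuous_re).mem_nhds
          (by simp only [mem_ofPred_eq, hure]; linarith)
      filter_upwards [hU] with u hu
      have hu' : 1 < u.re := hu
      rw [riemannZeta₁_one_sub (by linarith) (by rintro rfl; simp at hu')]
      simp only [K, Pi.mul_apply]
      ring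
    have h3 : HasDerivAt (fun u => riemannZeta₁ (1 - u)) (-deriv riemannZeta₁ (1 - u₀)) u₀ := by
      have h5 := differentiable_riemannZeta₁ (1 - u₀)
      exact h5.hasDerivAt.comp_const_sub 1 u₀
    have h4 := h1.unique h3
    have h6 : (1 - u₀) = -2 * ((n : ℂ) + 1) := by rw [hu₀]; ring
    rw [h6] at h4
    intro h
    rw [h, neg_zero] at h4
    have hpi2 : (π : ℂ) ≠ 0 := by simp [Real.pi_ne_zero]
    simp [hK0, hsin, hpi2] at h4
  have h := hA.analyticOrderAt_sub_eq_one_of_deriv_ne_zero hder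
  rw [riemannZeta₁_neg_two_mul] at h
  simp only [sub_zero] at h
  have h' : analyticOrderAt riemannZeta₁ (-2 * ((n : ℂ) + 1)) = 1 := h
  rw [analyticOrderNatAt, h']
  rfl

theorem mem_zerosIn_riemannZeta₁ {z : ℂ} {r : ℝ} :
    z ∈ zerosIn riemannZeta₁ r ↔ ‖z‖ ≤ r ∧ riemannZeta₁ z = 0 :=
  differentiable_riemannZeta₁.mem_zerosIn (by rw [riemannZeta₁_zero]; norm_num)

theorem tendsto_sum_zerosIn_riemannZeta₁ {s : ℂ} (hs : riemannZeta₁ s ≠ 0) :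
    Tendsto (fun r : ℝ => ∑ z ∈ zerosIn riemannZeta₁ r,
      (analyticOrderNatAt riemannZeta₁ z : ℂ) * (1 / (s - z) + 1 / z)) atTop
      (𝓝 (logDeriv riemannZeta₁ s - ((Real.log (2 * π) - 1 : ℝ) : ℂ))) := by
  rw [← logDeriv_riemannZeta₁_zero]
  exact differentiable_riemannZeta₁.tendsto_sum_zerosIn (by rw [riemannZeta₁_zero]; norm_num)
    (A := 22) (R := 2) (fun w hw => norm_riemannZeta₁_le_exp hw) hs

theorem neg_two_mul_re (n : ℕ) : (-2 * ((n : ℂ) + 1)).re = -2 * (n + 1) := by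
  simp

theorem norm_neg_two_mul (n : ℕ) : ‖(-2 * ((n : ℂ) + 1))‖ = 2 * (n + 1) := by
  rw [norm_mul, norm_neg, Complex.norm_ofNat]
  congr 1
  exact_mod_cast Complex.norm_natCast (n + 1)

theorem norm_neg_two_mul_add_one (n : ℕ) : ‖(-2 * ((n : ℂ) + 1)) + 1‖ = 2 * n + 1 := by
  rw [← norm_neg, show -(-2 * ((n : ℂ) + 1) + 1) = ((2 * n + 1 : ℕ) : ℂ) by push_cast; ring,
    Complex.norm_natCast]
  push_cast; ring

theorem sum_zerosIn_riemannZeta₁_filter_ne (hRH : RiemannHypothesis) {M : Type*} [AddCommMonoid M]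
    (f : ℂ → M) (N : ℕ) :
    ∑ z ∈ (zerosIn riemannZeta₁ (2 * N)).filter (fun z => ¬ z.re = 1 / 2), f z =
      ∑ n ∈ Finset.range N, f (-2 * (n + 1)) := by
  classical
  have : (zerosIn riemannZeta₁ (2 * N)).filter (fun z => ¬ z.re = 1 / 2) =
      (Finset.range N).image (fun n : ℕ => -2 * ((n : ℂ) + 1)) := by
    ext z
    simp only [Finset.mem_filter, mem_zerosIn_riemannZeta₁, Finset.mem_image, Finset.mem_range]
    constructor
    · rintro ⟨⟨h1, h2⟩, h3⟩
      rcases riemannZeta₁_eq_zero_imp hRH h2 with ⟨n, rfl⟩ | h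
      · refine ⟨n, ?_, rfl⟩
        rw [norm_neg_two_mul] at h1
        have : ((n + 1 : ℕ) : ℝ) ≤ N := by push_cast; linarith
        exact_mod_cast this
      · exact absurd h h3
    · rintro ⟨n, hn, rfl⟩
      refine ⟨⟨?_, riemannZeta₁_neg_two_mul n⟩, ?_⟩
      · rw [norm_neg_two_mul]
        have : ((n + 1 : ℕ) : ℝ) ≤ N := by exact_mod_cast hn
        push_cast at this
        linarith
      · rw [neg_two_mul_re]
        have : (0 : ℝ) ≤ n := n.cast_nonneg
        intro h
        linarith
  rw [this, Finset.sum_image]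
  intro a _ b _ hab
  have := congrArg Complex.re hab
  simp only [neg_two_mul_re] at this
  have : (a : ℝ) = b := by linarith
  exact_mod_cast this

theorem sum_range_inv_mul_le_one_sub_log_two (N : ℕ) :
    ∑ n ∈ Finset.range N, 1 / ((2 * (n + 1) : ℝ) * (2 * n + 3)) ≤ 1 - Real.log 2 := by
  have h1 : ∀ N : ℕ, ∑ n ∈ Finset.range N, 1 / ((2 * (n + 1) : ℝ) * (2 * n + 3)) =
      1 - ((harmonic (2 * N + 1) : ℝ) - harmonic N) := by
    intro N
    induction N with
    | zero => simp [harmonic]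
    | succ k ih =>
      rw [Finset.sum_range_succ, ih, show 2 * (k + 1) + 1 = 2 * k + 1 + 1 + 1 by ring,
        harmonic_succ (2 * k + 1 + 1), harmonic_succ (2 * k + 1), harmonic_succ k]
      push_cast
      have : (2 * (k : ℝ) + 1 + 1 + 1) ≠ 0 := by positivity
      have : (2 * (k : ℝ) + 1 + 1) ≠ 0 := by positivity
      have : (2 * (k : ℝ) + 3) ≠ 0 := by positivity
      have : ((k : ℝ) + 1) ≠ 0 := by positivity
      field_simp
      ring
  rw [h1]
  have h2 := strictMono_eulerMascheroniSeq.monotone (show N ≤ 2 * N + 1 by omega)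
  simp only [eulerMascheroniSeq] at h2
  have h3 : Real.log ((2 * N + 1 : ℕ) + 1) = Real.log 2 + Real.log (N + 1) := by
    rw [← Real.log_mul (by norm_num) (by positivity)]
    congr 1; push_cast; ring
  rw [h3] at h2
  linarith

theorem sum_range_inv_mul_le_three_fourths (N : ℕ) :
    ∑ n ∈ Finset.range N, 1 / ((2 * (n + 1) : ℝ) * (2 * n + 1)) ≤ 3 / 4 := by
  have h1 : ∀ N : ℕ, ∑ n ∈ Finset.range (N + 1), 1 / ((2 * (n + 1) : ℝ) * (2 * n + 1)) ≤
      3 / 4 - 1 / (4 * (N + 1)) := by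
    intro N
    induction N with
    | zero => norm_num
    | succ k ih =>
      rw [Finset.sum_range_succ]
      have h2 : 1 / ((2 * ((k + 1 : ℕ) + 1) : ℝ) * (2 * (k + 1 : ℕ) + 1)) ≤
          1 / (4 * (k + 1) * (k + 2)) := by
        apply one_div_le_one_div_of_le (by positivity)
        push_cast
        nlinarith [(k.cast_nonneg : (0 : ℝ) ≤ k)]
      have h3 : 1 / (4 * ((k : ℝ) + 1) * (k + 2)) =
          1 / (4 * (k + 1)) - 1 / (4 * ((k + 1 : ℕ) + 1)) := by
        push_cast
        field_simp
        ring
      linarith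
  calc _ ≤ ∑ n ∈ Finset.range (N + 1), 1 / ((2 * (n + 1) : ℝ) * (2 * n + 1)) :=
        Finset.sum_le_sum_of_subset_of_nonneg (Finset.range_mono (by omega))
          fun i _ _ => by positivity
    _ ≤ _ := h1 N
    _ ≤ 3 / 4 := by
      have : (0 : ℝ) ≤ 1 / (4 * (N + 1)) := by positivity
      linarith

theorem sum_zerosIn_riemannZeta₁_filter_eq_le (hRH : RiemannHypothesis) (r : ℝ) :
    ∑ z ∈ (zerosIn riemannZeta₁ r).filter (fun z => z.re = 1 / 2),
      (analyticOrderNatAt riemannZeta₁ z : ℝ) / ‖z‖ ^ 2 ≤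
      eulerMascheroniConstant + 2 - Real.log (4 * π) := by
  have hlog : Real.log (4 * π) = Real.log 2 + Real.log (2 * π) := by
    rw [← Real.log_mul (by norm_num) (by positivity)]; ring_nf
  set g : ℝ → ℝ := fun r => ∑ z ∈ (zerosIn riemannZeta₁ r).filter (fun z => z.re = 1 / 2),
      (analyticOrderNatAt riemannZeta₁ z : ℝ) / ‖z‖ ^ 2 with hg
  have hmono : Monotone g := by
    intro a b hab
    refine Finset.sum_le_sum_of_subset_of_nonneg ?_ fun _ _ _ => by positivity
    intro z
    simp only [Finset.mem_filter, mem_zerosIn_riemannZeta₁]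
    rintro ⟨⟨h1, h2⟩, h3⟩
    exact ⟨⟨h1.trans hab, h2⟩, h3⟩
  have hT := tendsto_sum_zerosIn_riemannZeta₁ (s := 1) (by simp)
  rw [logDeriv_riemannZeta₁_one] at hT
  have hT2 : Tendsto (fun N : ℕ => (2 * N : ℝ)) atTop atTop :=
    tendsto_natCast_atTop_atTop.const_mul_atTop (by norm_num)
  have hT3 := (Complex.continuous_re.tendsto _).comp (hT.comp hT2)
  have hre : ∀ N : ℕ, (∑ z ∈ zerosIn riemannZeta₁ (2 * N),
      (analyticOrderNatAt riemannZeta₁ z : ℂ) * (1 / (1 - z) + 1 / z)).re =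
      g (2 * N) - ∑ n ∈ Finset.range N, 1 / ((2 * (n + 1) : ℝ) * (2 * n + 3)) := by
    intro N
    rw [Complex.re_sum, ← Finset.sum_filter_add_sum_filter_not _ (fun z : ℂ => z.re = 1 / 2),
      sum_zerosIn_riemannZeta₁_filter_ne hRH, sub_eq_add_neg, ← Finset.sum_neg_distrib]
    congr 1
    · refine Finset.sum_congr rfl fun z hz => ?_
      have hz : z.re = 1 / 2 := (Finset.mem_filter.1 hz).2
      rw [← Complex.ofReal_natCast, Complex.re_ofReal_mul, div_eq_mul_inv _ (‖z‖ ^ 2)]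
      congr 1
      have h1 : Complex.normSq (1 - z) = Complex.normSq z := by
        rw [Complex.normSq_apply, Complex.normSq_apply]
        simp [hz]; norm_num
      have h2 : Complex.normSq z ≠ 0 := by
        rw [Complex.normSq_apply, hz]
        nlinarith [mul_self_nonneg z.im]
      rw [← Complex.normSq_eq_norm_sq]
      rw [Complex.add_re, one_div, one_div, Complex.inv_re, Complex.inv_re, h1, Complex.sub_re,
        Complex.one_re, hz]
      field_simp
      norm_num
    · refine Finset.sum_congr rfl fun n hn => ?_
      rw [analyticOrderNatAt_riemannZeta₁_neg_two_mul]
      have e : ((1 : ℕ) : ℂ) * (1 / (1 - -2 * ((n : ℂ) + 1)) + 1 / (-2 * (n + 1))) =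
          ((-(1 / ((2 * (n + 1) : ℝ) * (2 * n + 3))) : ℝ) : ℂ) := by
        have h1 : (1 - -2 * ((n : ℂ) + 1)) = 2 * n + 3 := by ring
        rw [h1]
        have h2 : (2 * (n : ℂ) + 3) ≠ 0 := by exact_mod_cast (show 2 * n + 3 ≠ 0 by omega)
        have h3 : ((n : ℂ) + 1) ≠ 0 := by exact_mod_cast (show n + 1 ≠ 0 by omega)
        push_cast
        field_simp
        ring
      rw [e, Complex.ofReal_re]
  have hle : ∀ᶠ N : ℕ in atTop, g r - (1 - Real.log 2) ≤ (∑ z ∈ zerosIn riemannZeta₁ (2 * N),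
      (analyticOrderNatAt riemannZeta₁ z : ℂ) * (1 / (1 - z) + 1 / z)).re := by
    filter_upwards [hT2.eventually_ge_atTop r] with N hN
    rw [hre]
    have h1 := hmono hN
    have h2 := sum_range_inv_mul_le_one_sub_log_two N
    linarith
  have := ge_of_tendsto hT3 hle
  simp only [Complex.sub_re, Complex.ofReal_re] at this
  change g r ≤ _
  linarith

theorem continuous_integrable_hasSum_fourier_tsum {ι : Type*} [Countable ι] {F : ι → ℝ → ℂ}
    {u : ι → ℝ} (hc : ∀ i, Continuous (F i)) (hu : Summable u) (hb : ∀ i t, ‖F i t‖ ≤ u i)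
    (hi : ∀ i, Integrable (F i)) (hI : Summable fun i => ∫ t, ‖F i t‖) :
    Continuous (fun t => ∑' i, F i t) ∧ Integrable (fun t => ∑' i, F i t) ∧
      ∀ ξ, HasSum (fun i => 𝓕 (F i) ξ) (𝓕 (fun t => ∑' i, F i t) ξ) := by
  have hcont : Continuous (fun t => ∑' i, F i t) := continuous_tsum hc hu hb
  have hs : ∀ t, Summable fun i => F i t := fun t => hu.of_norm_bounded fun i => hb i t
  refine ⟨hcont, ⟨hcont.aestronglyMeasurable, ?_⟩, fun ξ => ?_⟩
  · rw [HasFiniteIntegral]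
    have h1 : ∀ i, ∫⁻ t, ‖F i t‖ₑ = ENNReal.ofReal (∫ t, ‖F i t‖) := fun i =>
      (ofReal_integral_norm_eq_lintegral_enorm (hi i)).symm
    calc ∫⁻ t, ‖∑' i, F i t‖ₑ ≤ ∫⁻ t, ∑' i, ‖F i t‖ₑ := by
          refine lintegral_mono fun t => enorm_tsum_le_tsum_enorm
      _ = ∑' i, ∫⁻ t, ‖F i t‖ₑ := lintegral_tsum fun i => (hi i).1.enorm
      _ = ∑' i, ENNReal.ofReal (∫ t, ‖F i t‖) := by simp_rw [h1]
      _ < ⊤ := by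
        rw [← ENNReal.ofReal_tsum_of_nonneg (fun i => integral_nonneg fun t => norm_nonneg _) hI]
        exact ENNReal.ofReal_lt_top
  · simp_rw [Real.fourier_real_eq_integral_exp_smul]
    have hn : ∀ v : ℝ, ‖Complex.exp (((-2 * π * v * ξ : ℝ) : ℂ) * Complex.I)‖ = 1 := fun v =>
      Complex.norm_exp_ofReal_mul_I _
    have := hasSum_integral_of_summable_integral_norm (μ := volume)
      (F := fun i (v : ℝ) => Complex.exp (((-2 * π * v * ξ : ℝ) : ℂ) * Complex.I) • F i v)
      (fun i => by
        refine (hi i).bdd_mul (c := 1) (Continuous.aestronglyMeasurable (by fun_prop)) ?_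
        exact Eventually.of_forall fun v => (hn v).le)
      (by simpa only [norm_smul, hn, one_mul] using hI)
    have e : ∀ v : ℝ, Complex.exp (((-2 * π * v * ξ : ℝ) : ℂ) * Complex.I) • ∑' i, F i v =
        ∑' i, Complex.exp (((-2 * π * v * ξ : ℝ) : ℂ) * Complex.I) • F i v := fun v =>
      ((hs v).tsum_const_smul _).symm
    simp_rw [e]
    exact this

/-- The function `(e ^ (a t) - 1) e ^ (-3 t)` on `t ≥ 0`, extended by zero. -/
noncomputable def expRamp (a : ℂ) (t : ℝ) : ℂ :=
  (Complex.exp (a * (max t 0 : ℝ)) - 1) * Complex.exp (-3 * t)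

theorem expRamp_of_nonpos (a : ℂ) {t : ℝ} (ht : t ≤ 0) : expRamp a t = 0 := by
  simp [expRamp, max_eq_right ht]

theorem expRamp_eq_indicator (a : ℂ) : expRamp a = (Ioi (0 : ℝ)).indicator
    (fun t : ℝ => Complex.exp ((a - 3) * t) - Complex.exp (-3 * t)) := by
  ext t
  rcases le_or_gt t 0 with ht | ht
  · rw [expRamp_of_nonpos a ht, indicator_of_notMem (by simpa using ht)]
  · rw [indicator_of_mem (by exact ht), expRamp, max_eq_left ht.le, sub_mul, one_mul,
      ← Complex.exp_add]
    ring_nf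

theorem continuous_expRamp (a : ℂ) : Continuous (expRamp a) := by
  unfold expRamp
  fun_prop

theorem norm_expRamp_le {a : ℂ} (ha : a.re ≤ 2) (t : ℝ) :
    ‖expRamp a t‖ ≤ (Ioi (0 : ℝ)).indicator
      (fun t : ℝ => Real.exp (-1 * t) + Real.exp (-3 * t)) t := by
  rw [expRamp_eq_indicator, norm_indicator_eq_indicator_norm]
  refine indicator_le_indicator' fun ht => ?_
  have ht' : 0 < t := ht
  refine (norm_sub_le _ _).trans (add_le_add ?_ ?_)
  · rw [Complex.norm_exp]
    apply Real.exp_le_exp.2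
    simp
    nlinarith
  · rw [Complex.norm_exp]
    simp

theorem norm_expRamp_le_two {a : ℂ} (ha : a.re ≤ 2) (t : ℝ) : ‖expRamp a t‖ ≤ 2 := by
  refine (norm_expRamp_le ha t).trans ?_
  refine indicator_apply_le' (fun ht => ?_) fun _ => by norm_num
  have ht' : 0 < t := ht
  have h1 : Real.exp (-1 * t) ≤ 1 := Real.exp_le_one_iff.2 (by linarith)
  have h2 : Real.exp (-3 * t) ≤ 1 := Real.exp_le_one_iff.2 (by linarith)
  linarith

theorem integrable_expRamp_bound : Integrable ((Ioi (0 : ℝ)).indicator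
    (fun t : ℝ => Real.exp (-1 * t) + Real.exp (-3 * t))) := by
  rw [integrable_indicator_iff measurableSet_Ioi]
  exact (integrableOn_exp_mul_Ioi (by norm_num) 0).add (integrableOn_exp_mul_Ioi (by norm_num) 0)

theorem integrable_expRamp {a : ℂ} (ha : a.re ≤ 2) : Integrable (expRamp a) :=
  integrable_expRamp_bound.mono' (continuous_expRamp a).aestronglyMeasurable
    (Eventually.of_forall (norm_expRamp_le ha))

theorem exists_integral_norm_expRamp_le :
    ∃ B : ℝ, ∀ a : ℂ, a.re ≤ 2 → ∫ t, ‖expRamp a t‖ ≤ B :=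
  ⟨_, fun _ ha => integral_mono (integrable_expRamp ha).norm integrable_expRamp_bound
    (norm_expRamp_le ha)⟩

theorem fourier_expRamp {a : ℂ} (ha : a.re ≤ 2) (ξ : ℝ) :
    𝓕 (expRamp a) ξ = 1 / (3 + 2 * π * ξ * Complex.I - a) - 1 / (3 + 2 * π * ξ * Complex.I) := by
  set w : ℂ := 3 + 2 * π * ξ * Complex.I with hw
  have hwre : w.re = 3 := by simp [hw]
  rw [Real.fourier_real_eq_integral_exp_smul, expRamp_eq_indicator]
  have h1 : ∀ v : ℝ, Complex.exp (((-2 * π * v * ξ : ℝ) : ℂ) * Complex.I) •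
      (Ioi (0 : ℝ)).indicator
        (fun t : ℝ => Complex.exp ((a - 3) * t) - Complex.exp (-3 * t)) v =
      (Ioi (0 : ℝ)).indicator
        (fun t : ℝ => Complex.exp ((a - w) * t) - Complex.exp (-w * t)) v := by
    intro v
    by_cases hv : v ∈ Ioi (0 : ℝ)
    · rw [indicator_of_mem hv, indicator_of_mem hv, smul_eq_mul, mul_sub, ← Complex.exp_add,
        ← Complex.exp_add, hw]
      congr 2
      · push_cast; ring
      · push_cast; ring
    · rw [indicator_of_notMem hv, indicator_of_notMem hv, smul_zero]
  simp_rw [h1]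
  have h2 : (a - w).re < 0 := by rw [Complex.sub_re, hwre]; linarith
  have h3 : (-w).re < 0 := by rw [Complex.neg_re, hwre]; norm_num
  rw [integral_indicator measurableSet_Ioi, integral_sub (integrableOn_exp_mul_complex_Ioi h2 0)
    (integrableOn_exp_mul_complex_Ioi h3 0), integral_exp_mul_complex_Ioi h2,
    integral_exp_mul_complex_Ioi h3]
  have h4 : a - w ≠ 0 := by intro h; rw [h] at h2; simp at h2
  have h5 : w ≠ 0 := by intro h; rw [h] at h3; simp at h3
  have h6 : w - a ≠ 0 := by intro h; apply h4; linear_combination -h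
  simp only [Complex.ofReal_zero, mul_zero, Complex.exp_zero]
  have h7 : -1 / (a - w) = 1 / (w - a) := by
    rw [← neg_sub, div_neg, neg_div, neg_neg]
  rw [h7, neg_div_neg_eq]

theorem fourier_comp_sub_const (f : ℝ → ℂ) (b ξ : ℝ) :
    𝓕 (fun t => f (t - b)) ξ = Complex.exp (-(2 * π * ξ * Complex.I) * b) * 𝓕 f ξ := by
  rw [Real.fourier_real_eq_integral_exp_smul, Real.fourier_real_eq_integral_exp_smul,
    ← integral_const_mul, ← integral_sub_right_eq_self
      (fun v : ℝ => Complex.exp (-(2 * π * ξ * Complex.I) * b) *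
        (Complex.exp (((-2 * π * v * ξ : ℝ) : ℂ) * Complex.I) • f v)) b]
  congr 1
  ext v
  rw [smul_eq_mul, smul_eq_mul, ← mul_assoc, ← Complex.exp_add]
  congr 2
  push_cast; ring

/-- The zeros of `(s - 1) ζ(s)`. -/
abbrev ZetaZero : Type := {z : ℂ // riemannZeta₁ z = 0}

instance : Countable ZetaZero := by
  have : ({z : ℂ | riemannZeta₁ z = 0}).Countable := by
    refine (countable_iUnion fun n : ℕ => (zerosIn riemannZeta₁ n).countable_toSet).mono ?_
    intro z hz
    obtain ⟨n, hn⟩ := exists_nat_ge ‖z‖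
    exact mem_iUnion.2 ⟨n, Finset.mem_coe.2 (mem_zerosIn_riemannZeta₁.2 ⟨hn, hz⟩)⟩
  exact this.to_subtype

/-- The multiplicity of `z` as a zero of `(s - 1) ζ(s)`. -/
noncomputable abbrev zetaMult (z : ℂ) : ℕ := analyticOrderNatAt riemannZeta₁ z

theorem ZetaZero.re_le (hRH : RiemannHypothesis) (z : ZetaZero) : z.1.re ≤ 1 / 2 := by
  rcases riemannZeta₁_eq_zero_imp hRH z.2 with ⟨n, hn⟩ | h
  · rw [hn, neg_two_mul_re]
    have : (0 : ℝ) ≤ n := n.cast_nonneg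
    linarith
  · exact h.le

theorem ZetaZero.ne_zero (z : ZetaZero) : z.1 ≠ 0 := by
  intro h
  have := z.2
  rw [h, riemannZeta₁_zero] at this
  norm_num at this

theorem ZetaZero.add_one_ne_zero (hRH : RiemannHypothesis) (z : ZetaZero) : z.1 + 1 ≠ 0 := by
  rcases riemannZeta₁_eq_zero_imp hRH z.2 with ⟨n, hn⟩ | h
  · rw [hn, ← norm_ne_zero_iff, norm_neg_two_mul_add_one]
    positivity
  · intro h1
    have := congrArg Complex.re h1
    simp [h] at this
    norm_num at this

theorem norm_le_norm_add_one {z : ℂ} (hz : z.re = 1 / 2) : ‖z‖ ≤ ‖z + 1‖ := by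
  apply le_of_sq_le_sq _ (norm_nonneg _)
  rw [← Complex.normSq_eq_norm_sq, ← Complex.normSq_eq_norm_sq, Complex.normSq_apply,
    Complex.normSq_apply]
  simp [hz]
  norm_num

/-- A majorant for the terms in the explicit formula. -/
noncomputable def zeroMajorant (c : ℝ) (z : ℂ) : ℝ :=
  if z.re = 1 / 2 then c * (zetaMult z / ‖z‖ ^ 2) else zetaMult z / (‖z‖ * ‖z + 1‖)

theorem zeroMajorant_nonneg {c : ℝ} (hc : 0 ≤ c) (z : ℂ) : 0 ≤ zeroMajorant c z := by
  unfold zeroMajorant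
  split_ifs <;> positivity

theorem sum_zeroMajorant_le (hRH : RiemannHypothesis) {c : ℝ} (hc : 0 ≤ c)
    (s : Finset ZetaZero) : ∑ z ∈ s, zeroMajorant c z ≤
      c * (eulerMascheroniConstant + 2 - Real.log (4 * π)) + 3 / 4 := by
  classical
  obtain ⟨N, hN⟩ := exists_nat_ge (∑ z ∈ s, ‖z.1‖)
  have hN0 : (0 : ℝ) ≤ N := N.cast_nonneg
  calc ∑ z ∈ s, zeroMajorant c z = ∑ z ∈ s.image Subtype.val, zeroMajorant c z := by
        rw [Finset.sum_image Subtype.val_injective.injOn]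
    _ ≤ ∑ z ∈ zerosIn riemannZeta₁ (2 * N), zeroMajorant c z := by
      refine Finset.sum_le_sum_of_subset_of_nonneg ?_ fun z _ _ => zeroMajorant_nonneg hc z
      intro z hz
      obtain ⟨w, hw, rfl⟩ := Finset.mem_image.1 hz
      refine mem_zerosIn_riemannZeta₁.2 ⟨?_, w.2⟩
      have := Finset.single_le_sum (f := fun z : ZetaZero => ‖z.1‖)
        (fun i _ => norm_nonneg _) hw
      linarith
    _ = c * ∑ z ∈ (zerosIn riemannZeta₁ (2 * N)).filter (fun z => z.re = 1 / 2),
          (zetaMult z : ℝ) / ‖z‖ ^ 2 +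
        ∑ n ∈ Finset.range N, 1 / ((2 * (n + 1) : ℝ) * (2 * n + 1)) := by
      rw [← Finset.sum_filter_add_sum_filter_not _ (fun z : ℂ => z.re = 1 / 2),
        sum_zerosIn_riemannZeta₁_filter_ne hRH, Finset.mul_sum]
      congr 1
      · refine Finset.sum_congr rfl fun z hz => ?_
        rw [zeroMajorant, if_pos (Finset.mem_filter.1 hz).2]
      · refine Finset.sum_congr rfl fun n _ => ?_
        have h : ¬ (-2 * ((n : ℂ) + 1)).re = 1 / 2 := by
          rw [neg_two_mul_re]
          have : (0 : ℝ) ≤ n := n.cast_nonneg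
          intro h
          linarith
        rw [zeroMajorant, if_neg h, zetaMult, analyticOrderNatAt_riemannZeta₁_neg_two_mul,
          norm_neg_two_mul, norm_neg_two_mul_add_one, Nat.cast_one]
    _ ≤ _ := add_le_add (mul_le_mul_of_nonneg_left
        (sum_zerosIn_riemannZeta₁_filter_eq_le hRH _) hc) (sum_range_inv_mul_le_three_fourths N)

theorem summable_zeroMajorant (hRH : RiemannHypothesis) {c : ℝ} (hc : 0 ≤ c) :
    Summable fun z : ZetaZero => zeroMajorant c z :=
  summable_of_sum_le (fun z => zeroMajorant_nonneg hc z) (sum_zeroMajorant_le hRH hc)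

theorem tsum_zeroMajorant_le (hRH : RiemannHypothesis) {c : ℝ} (hc : 0 ≤ c) :
    ∑' z : ZetaZero, zeroMajorant c z ≤
      c * (eulerMascheroniConstant + 2 - Real.log (4 * π)) + 3 / 4 :=
  (summable_zeroMajorant hRH hc).tsum_le_of_sum_le (sum_zeroMajorant_le hRH hc)

theorem summable_zetaMult_div (hRH : RiemannHypothesis) :
    Summable fun z : ZetaZero => (zetaMult z : ℝ) / (‖z.1‖ * ‖z.1 + 1‖) := by
  refine (summable_zeroMajorant hRH zero_le_one).of_nonneg_of_le (fun z => by positivity)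
    fun z => ?_
  rw [zeroMajorant]
  split_ifs with h
  · rw [one_mul, pow_two]
    have := norm_pos_iff.2 z.ne_zero
    have := norm_le_norm_add_one h
    gcongr
  · exact le_rfl

theorem tendsto_subtype_zerosIn : Tendsto (fun r : ℝ =>
    (zerosIn riemannZeta₁ r).subtype (fun z => riemannZeta₁ z = 0)) atTop atTop := by
  refine tendsto_atTop_finset_of_monotone ?_ ?_
  · intro a b hab z
    simp only [Finset.mem_subtype, mem_zerosIn_riemannZeta₁]
    rintro ⟨h1, h2⟩
    exact ⟨h1.trans hab, h2⟩
  · intro z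
    exact ⟨‖z.1‖, by simp only [Finset.mem_subtype, mem_zerosIn_riemannZeta₁]; exact ⟨le_rfl, z.2⟩⟩

theorem hasSum_zetaZero (hRH : RiemannHypothesis) {s : ℂ} (hs : 1 < s.re) :
    HasSum (fun z : ZetaZero => (zetaMult z : ℂ) * (1 / (s - z) + 1 / z))
      (logDeriv riemannZeta₁ s - ((Real.log (2 * π) - 1 : ℝ) : ℂ)) := by
  have hsum : Summable fun z : ZetaZero => (zetaMult z : ℂ) * (1 / (s - z) + 1 / z) := by
    refine ((summable_zetaMult_div hRH).mul_left (‖s‖ * (1 + 2 * ‖s + 1‖))).of_norm_bounded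
      fun z => ?_
    have hre : 1 / 2 ≤ ‖s - z‖ := by
      refine le_trans ?_ (Complex.re_le_norm _)
      have := z.re_le hRH
      rw [Complex.sub_re]; linarith
    have hz0 := norm_pos_iff.2 z.ne_zero
    have hz1 := norm_pos_iff.2 (z.add_one_ne_zero hRH)
    have hsz : s - z.1 ≠ 0 := norm_pos_iff.1 (by linarith)
    have h1 : ‖z.1 + 1‖ ≤ (1 + 2 * ‖s + 1‖) * ‖s - z‖ := by
      have : ‖z.1 + 1‖ ≤ ‖s + 1‖ + ‖s - z‖ := by
        rw [show z.1 + 1 = (s + 1) - (s - z) by ring]; exact norm_sub_le _ _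
      nlinarith [norm_nonneg (s + 1)]
    have h2 : 1 / (s - z) + 1 / z.1 = s / (z * (s - z)) := by
      have := z.ne_zero
      field_simp
      ring
    rw [h2, norm_mul, norm_div, norm_mul, Complex.norm_natCast]
    have h3 : ‖s‖ / (‖z.1‖ * ‖s - z‖) ≤ ‖s‖ * (1 + 2 * ‖s + 1‖) / (‖z.1‖ * ‖z.1 + 1‖) := by
      rw [div_le_div_iff₀ (by positivity) (by positivity)]
      calc ‖s‖ * (‖z.1‖ * ‖z.1 + 1‖) ≤ ‖s‖ * (‖z.1‖ * ((1 + 2 * ‖s + 1‖) * ‖s - z‖)) := by gcongr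
        _ = _ := by ring
    calc (zetaMult z : ℝ) * (‖s‖ / (‖z.1‖ * ‖s - z‖)) ≤
        zetaMult z * (‖s‖ * (1 + 2 * ‖s + 1‖) / (‖z.1‖ * ‖z.1 + 1‖)) := by gcongr
      _ = _ := by ring
  have hs1 : s ≠ 1 := by rintro rfl; simp at hs
  have hs0 : riemannZeta₁ s ≠ 0 := by
    rw [riemannZeta₁_eq_sub_mul hs1]
    exact mul_ne_zero (sub_ne_zero.2 hs1) (riemannZeta_ne_zero_of_one_le_re hs.le)
  have h1 := tendsto_sum_zerosIn_riemannZeta₁ hs0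
  have h2 := hsum.hasSum.comp tendsto_subtype_zerosIn
  have h3 := tendsto_nhds_unique h1 (h2.congr fun r => ?_)
  · rw [h3]; exact hsum.hasSum
  · simp only [Function.comp_apply]
    exact Finset.sum_subtype_of_mem (fun z => (zetaMult z : ℂ) * (1 / (s - z) + 1 / z))
      fun z hz => (mem_zerosIn_riemannZeta₁.1 hz).2

theorem expRamp_series {ι : Type*} [Countable ι] {c a : ι → ℂ} {b : ι → ℝ}
    (hc : Summable fun i => ‖c i‖) (ha : ∀ i, (a i).re ≤ 2) :
    Continuous (fun t => ∑' i, c i * expRamp (a i) (t - b i)) ∧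
      Integrable (fun t => ∑' i, c i * expRamp (a i) (t - b i)) ∧
      ∀ ξ : ℝ, HasSum (fun i => c i * (Complex.exp (-(2 * π * ξ * Complex.I) * b i) *
        (1 / (3 + 2 * π * ξ * Complex.I - a i) - 1 / (3 + 2 * π * ξ * Complex.I))))
        (𝓕 (fun t => ∑' i, c i * expRamp (a i) (t - b i)) ξ) := by
  obtain ⟨B, hB⟩ := exists_integral_norm_expRamp_le
  obtain ⟨h1, h2, h3⟩ := continuous_integrable_hasSum_fourier_tsum
    (F := fun i t => c i * expRamp (a i) (t - b i)) (u := fun i => ‖c i‖ * 2)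
    (fun i => ((continuous_expRamp (a i)).comp (continuous_sub_right (b i))).const_mul (c i))
    (hc.mul_right 2)
    (fun i t => by
      rw [norm_mul]
      exact mul_le_mul_of_nonneg_left (norm_expRamp_le_two (ha i) _) (norm_nonneg _))
    (fun i => ((integrable_expRamp (ha i)).comp_sub_right (b i)).const_mul (c i))
    ((hc.mul_right B).of_nonneg_of_le (fun i => integral_nonneg fun t => norm_nonneg _)
      fun i => by
        simp_rw [norm_mul]
        rw [integral_const_mul, integral_sub_right_eq_self (fun t => ‖expRamp (a i) t‖)]
        exact mul_le_mul_of_nonneg_left (hB _ (ha i)) (norm_nonneg _))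
  refine ⟨h1, h2, fun ξ => ?_⟩
  convert h3 ξ using 2 with i
  rw [← fourier_expRamp (ha i), ← fourier_comp_sub_const, Real.fourier_real_eq_integral_exp_smul,
    Real.fourier_real_eq_integral_exp_smul, ← integral_const_mul]
  congr 1
  ext v
  rw [smul_eq_mul, smul_eq_mul]
  ring

theorem eq_zero_of_fourier_eq_zero {h : ℝ → ℂ} (hc : Continuous h) (hi : Integrable h)
    (h0 : ∀ ξ, 𝓕 h ξ = 0) (t : ℝ) : h t = 0 := by
  have h1 : 𝓕 h = 0 := funext h0
  rw [← hc.fourierInv_fourier_eq hi (by rw [h1]; exact integrable_zero _ _ _), h1,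
    Real.fourierInv_eq]
  simp

theorem expRamp_log (a : ℂ) {x : ℝ} (hx : 1 ≤ x) :
    expRamp a (Real.log x) = ((x : ℂ) ^ a - 1) * (x : ℂ)⁻¹ ^ 3 := by
  have hx0 : (x : ℂ) ≠ 0 := by exact_mod_cast (by linarith : x ≠ 0)
  rw [expRamp, max_eq_left (Real.log_nonneg hx), Complex.ofReal_log (by linarith), mul_comm a,
    ← Complex.cpow_def_of_ne_zero hx0]
  congr 1
  rw [show -3 * Complex.log x = -((3 : ℕ) * Complex.log x) by push_cast; ring, Complex.exp_neg,
    Complex.exp_nat_mul, Complex.exp_log hx0, inv_pow]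

theorem vonMangoldt_mul_expRamp {x : ℝ} (hx : 1 ≤ x) (n : ℕ) :
    LSeries.term (fun n => (Λ n : ℂ)) 2 n * expRamp 1 (Real.log x - Real.log n) =
      if n ∈ Finset.Icc 1 ⌊x⌋₊ then ((Λ n * (x - n) : ℝ) : ℂ) * (x : ℂ)⁻¹ ^ 3 else 0 := by
  rcases Nat.eq_zero_or_pos n with rfl | hn
  · simp
  have hn0 : (0 : ℝ) < n := by exact_mod_cast hn
  have hnC : (n : ℂ) ≠ 0 := by exact_mod_cast hn.ne'
  have hxC : (x : ℂ) ≠ 0 := by exact_mod_cast (by linarith : x ≠ 0)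
  rw [← Real.log_div (by linarith) hn0.ne']
  have hmem : n ∈ Finset.Icc 1 ⌊x⌋₊ ↔ 1 ≤ n ∧ (n : ℝ) ≤ x := by
    rw [Finset.mem_Icc, Nat.le_floor_iff (by linarith)]
  simp only [hmem]
  split_ifs with h
  · have h1 : 1 ≤ x / n := by rw [le_div_iff₀ hn0]; linarith [h.2]
    rw [expRamp_log 1 h1, LSeries.term_of_ne_zero hn.ne', Complex.cpow_ofNat, Complex.cpow_one]
    push_cast
    field_simp
  · have h1 : x / n ≤ 1 := by
      rw [div_le_iff₀ hn0]
      by_contra h2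
      exact h ⟨hn, by linarith⟩
    rw [expRamp_of_nonpos 1 (Real.log_nonpos (by positivity) h1), mul_zero]

theorem term_two_mul_exp (ξ : ℝ) (n : ℕ) :
    LSeries.term (fun n => (Λ n : ℂ)) 2 n *
      Complex.exp (-(2 * π * ξ * Complex.I) * (Real.log n : ℝ)) =
      LSeries.term (fun n => (Λ n : ℂ)) (2 + 2 * π * ξ * Complex.I) n := by
  rcases Nat.eq_zero_or_pos n with rfl | hn
  · simp
  have hnC : (n : ℂ) ≠ 0 := by exact_mod_cast hn.ne'
  rw [LSeries.term_def₀ (by simp), LSeries.term_def₀ (by simp), mul_assoc, neg_add,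
    Complex.cpow_add _ _ hnC, Complex.natCast_log, Complex.cpow_def_of_ne_zero hnC
      (-(2 * π * ξ * Complex.I)), mul_comm (Complex.log n)]

theorem HasSum.of_eq {ι : Type*} {f g : ι → ℂ} {a : ℂ} (h : HasSum g a) (e : ∀ i, f i = g i) :
    HasSum f a := by
  rwa [funext e]

theorem hasSum_psiOne_explicit (hRH : RiemannHypothesis) {x : ℝ} (hx : 1 ≤ x) :
    HasSum (fun z : ZetaZero => (zetaMult z : ℂ) / (z * (z + 1)) * ((x : ℂ) ^ (z.1 + 1) - 1))
      (((x ^ 2 - 1) / 2 - Real.log (2 * π) * (x - 1) - psiOne x : ℝ) : ℂ) := by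
  set C : ℂ := ((Real.log (2 * π) - 1 : ℝ) : ℂ) with hC
  let c : Bool ⊕ ℕ ⊕ ZetaZero → ℂ := Sum.elim (fun i => bif i then -(1 / 2) else 1 + C)
    (Sum.elim (LSeries.term (fun n => (Λ n : ℂ)) 2)
      (fun z => (zetaMult z : ℂ) / (z * (z + 1))))
  let a : Bool ⊕ ℕ ⊕ ZetaZero → ℂ := Sum.elim (fun i => bif i then 2 else 1)
    (Sum.elim (fun _ => 1) (fun z => z + 1))
  let b : Bool ⊕ ℕ ⊕ ZetaZero → ℝ := Sum.elim (fun _ => 0)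
    (Sum.elim (fun n => Real.log n) (fun _ => 0))
  have hcZ : Summable fun z : ZetaZero => ‖(zetaMult z : ℂ) / (z * (z + 1))‖ := by
    refine (summable_zetaMult_div hRH).congr fun z => ?_
    rw [norm_div, norm_mul, Complex.norm_natCast]
  have hcN : Summable fun n => ‖LSeries.term (fun n => (Λ n : ℂ)) 2 n‖ :=
    (LSeriesSummable_vonMangoldt (s := 2) (by norm_num)).norm
  have hc : Summable fun i => ‖c i‖ :=
    ((hasSum_fintype fun i : Bool => ‖c (Sum.inl i)‖).sum
      (f := fun i => ‖c i‖) (hcN.hasSum.sum (f := fun i => ‖c (Sum.inr i)‖) hcZ.hasSum)).summable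
  have ha : ∀ i, (a i).re ≤ 2 := by
    rintro (i | n | z)
    · cases i <;> simp [a]
    · simp [a]
    · have := z.re_le hRH
      simp [a]
      linarith
  obtain ⟨h1, h2, h3⟩ := expRamp_series (b := b) hc ha
  have hzero : ∀ ξ : ℝ, 𝓕 (fun t => ∑' i, c i * expRamp (a i) (t - b i)) ξ = 0 := by
    intro ξ
    set s : ℂ := 2 + 2 * π * ξ * Complex.I with hs
    have hw : 3 + 2 * π * ξ * Complex.I = s + 1 := by rw [hs]; ring
    have hsre : s.re = 2 := by simp [hs]
    have hs0 : s ≠ 0 := by intro h; rw [h] at hsre; simp at hsre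
    have hs1 : s ≠ 1 := by intro h; rw [h] at hsre; simp at hsre
    have hs1' : s - 1 ≠ 0 := sub_ne_zero.2 hs1
    have hs2 : s + 1 ≠ 0 := by
      intro h
      have := congrArg Complex.re h
      simp [hsre] at this
      norm_num at this
    have hζ : riemannZeta s ≠ 0 := riemannZeta_ne_zero_of_one_le_re (by rw [hsre]; norm_num)
    have hsum := h3 ξ
    rw [hw] at hsum
    have eN : HasSum (fun n : ℕ => LSeries.term (fun n => (Λ n : ℂ)) s n * (1 / (s * (s + 1))))
        (-deriv riemannZeta s / riemannZeta s * (1 / (s * (s + 1)))) := by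
      have hs' : 1 < s.re := by rw [hsre]; norm_num
      rw [← LSeries_vonMangoldt_eq_deriv_riemannZeta_div hs']
      exact (LSeriesSummable_vonMangoldt hs').hasSum.mul_right _
    have eZ := (hasSum_zetaZero hRH (s := s) (by rw [hsre]; norm_num)).mul_right
      (1 / (s * (s + 1)))
    rw [logDeriv_riemannZeta₁ hs1 hζ] at eZ
    have kB : HasSum (fun i : Bool => c (Sum.inl i) *
        (Complex.exp (-(2 * π * ξ * Complex.I) * b (Sum.inl i)) *
          (1 / (s + 1 - a (Sum.inl i)) - 1 / (s + 1))))
        (-(1 / 2) * (1 / (s - 1) - 1 / (s + 1)) + (1 + C) * (1 / s - 1 / (s + 1))) := by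
      convert hasSum_fintype _ using 1
      rw [Fintype.sum_bool]
      simp only [c, a, b, Sum.elim_inl, cond_true, cond_false, Complex.ofReal_zero, mul_zero,
        Complex.exp_zero, one_mul]
      rw [show s + 1 - 2 = s - 1 by ring, show s + 1 - 1 = s by ring]
    have kN := HasSum.of_eq (f := fun n : ℕ => c (Sum.inr (Sum.inl n)) *
        (Complex.exp (-(2 * π * ξ * Complex.I) * b (Sum.inr (Sum.inl n))) *
          (1 / (s + 1 - a (Sum.inr (Sum.inl n))) - 1 / (s + 1)))) eN fun n => by
      simp only [c, a, b, Sum.elim_inl, Sum.elim_inr]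
      rw [← mul_assoc, term_two_mul_exp, ← hs]
      congr 1
      rw [show s + 1 - 1 = s by ring]
      field_simp
      ring
    have kZ := HasSum.of_eq (f := fun z : ZetaZero => c (Sum.inr (Sum.inr z)) *
        (Complex.exp (-(2 * π * ξ * Complex.I) * b (Sum.inr (Sum.inr z))) *
          (1 / (s + 1 - a (Sum.inr (Sum.inr z))) - 1 / (s + 1)))) eZ fun z => by
      simp only [c, a, b, Sum.elim_inr, Complex.ofReal_zero, mul_zero, Complex.exp_zero, one_mul]
      have hz := z.ne_zero
      have hz1 := z.add_one_ne_zero hRH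
      have hsz : s - z.1 ≠ 0 := by
        intro h
        have h4 := congrArg Complex.re h
        have := z.re_le hRH
        rw [Complex.sub_re, hsre, Complex.zero_re] at h4
        linarith
      rw [show s + 1 - (z.1 + 1) = s - z by ring]
      field_simp
      ring
    rw [hsum.unique (kB.sum (f := fun i => c i * (Complex.exp (-(2 * π * ξ * Complex.I) * b i) *
      (1 / (s + 1 - a i) - 1 / (s + 1)))) (kN.sum (f := fun i => c (Sum.inr i) *
        (Complex.exp (-(2 * π * ξ * Complex.I) * b (Sum.inr i)) *
          (1 / (s + 1 - a (Sum.inr i)) - 1 / (s + 1)))) kZ)), ← hC]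
    field_simp
    ring
  have hpt := eq_zero_of_fourier_eq_zero h1 h2 hzero (Real.log x)
  have hxC : (x : ℂ) ≠ 0 := by exact_mod_cast (by linarith : x ≠ 0)
  have hsummable : Summable fun i => c i * expRamp (a i) (Real.log x - b i) :=
    (hc.mul_right 2).of_norm_bounded fun i => by
      rw [norm_mul]
      exact mul_le_mul_of_nonneg_left (norm_expRamp_le_two (ha i) _) (norm_nonneg _)
  have pB : HasSum (fun i : Bool => c (Sum.inl i) *
      expRamp (a (Sum.inl i)) (Real.log x - b (Sum.inl i)))
      (-(1 / 2) * (((x : ℂ) ^ 2 - 1) * (x : ℂ)⁻¹ ^ 3) +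
        (1 + C) * (((x : ℂ) - 1) * (x : ℂ)⁻¹ ^ 3)) := by
    convert hasSum_fintype _ using 1
    rw [Fintype.sum_bool]
    simp only [c, a, b, Sum.elim_inl, cond_true, cond_false, sub_zero]
    rw [expRamp_log _ hx, expRamp_log _ hx, Complex.cpow_ofNat, Complex.cpow_one]
  have pN : HasSum (fun n : ℕ => c (Sum.inr (Sum.inl n)) *
      expRamp (a (Sum.inr (Sum.inl n))) (Real.log x - b (Sum.inr (Sum.inl n))))
      ((psiOne x : ℂ) * (x : ℂ)⁻¹ ^ 3) := by
    have e : (psiOne x : ℂ) * (x : ℂ)⁻¹ ^ 3 = ∑ n ∈ Finset.Icc 1 ⌊x⌋₊,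
        if n ∈ Finset.Icc 1 ⌊x⌋₊ then ((Λ n * (x - n) : ℝ) : ℂ) * (x : ℂ)⁻¹ ^ 3 else 0 := by
      rw [psiOne, Complex.ofReal_sum, Finset.sum_mul]
      exact Finset.sum_congr rfl fun n hn => by rw [if_pos hn]
    rw [e]
    exact (hasSum_sum_of_ne_finset_zero fun n hn => if_neg hn).of_eq
      fun n => vonMangoldt_mul_expRamp hx n
  have pZ : Summable fun z : ZetaZero => c (Sum.inr (Sum.inr z)) *
      expRamp (a (Sum.inr (Sum.inr z))) (Real.log x - b (Sum.inr (Sum.inr z))) :=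
    hsummable.comp_injective (Sum.inr_injective.comp Sum.inr_injective)
  have hall := pB.sum (f := fun i => c i * expRamp (a i) (Real.log x - b i))
    (pN.sum (f := fun i => c (Sum.inr i) *
      expRamp (a (Sum.inr i)) (Real.log x - b (Sum.inr i))) pZ.hasSum)
  rw [hall.tsum_eq] at hpt
  have hval : (((x ^ 2 - 1) / 2 - Real.log (2 * π) * (x - 1) - psiOne x : ℝ) : ℂ) =
      (∑' z : ZetaZero, c (Sum.inr (Sum.inr z)) *
        expRamp (a (Sum.inr (Sum.inr z))) (Real.log x - b (Sum.inr (Sum.inr z)))) *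
          (x : ℂ) ^ 3 := by
    rw [eq_neg_of_add_eq_zero_right ((add_assoc _ _ _).trans hpt), hC]
    push_cast
    field_simp
    ring
  rw [hval]
  refine (pZ.hasSum.mul_right ((x : ℂ) ^ 3)).of_eq fun z => ?_
  simp only [c, a, b, Sum.elim_inr, sub_zero]
  rw [expRamp_log _ hx]
  field_simp

theorem eulerMascheroniConstant_le_harmonic_sub_log (n : ℕ) :
    eulerMascheroniConstant ≤ harmonic n - Real.log (n + 1 / 2) := by
  have hanti : Antitone fun m : ℕ => (harmonic m : ℝ) - Real.log (m + 1 / 2) := by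
    refine antitone_nat_of_succ_le fun m => ?_
    have hm : (0 : ℝ) < m + 1 / 2 := by positivity
    have h1 := Real.le_log_one_add_of_nonneg (x := 1 / ((m : ℝ) + 1 / 2)) (by positivity)
    have h2 : 1 + 1 / ((m : ℝ) + 1 / 2) = ((m + 1 : ℕ) + 1 / 2) / (m + 1 / 2) := by
      push_cast
      field_simp
      ring
    have h3 : 2 * (1 / ((m : ℝ) + 1 / 2)) / (1 / ((m : ℝ) + 1 / 2) + 2) = ((m : ℝ) + 1)⁻¹ := by
      field_simp
      ring
    rw [h2, h3, Real.log_div (by positivity) hm.ne'] at h1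
    rw [harmonic_succ]
    push_cast at h1 ⊢
    linarith
  refine le_of_tendsto tendsto_eulerMascheroniSeq ?_
  filter_upwards [eventually_ge_atTop n] with m hm
  refine le_trans ?_ (hanti hm)
  rw [eulerMascheroniSeq]
  have : Real.log (m + 1 / 2) ≤ Real.log (m + 1) :=
    Real.log_le_log (by positivity) (by linarith)
  linarith

theorem eulerMascheroniConstant_add_two_sub_log_le :
    eulerMascheroniConstant + 2 - Real.log (4 * π) ≤ 0.0462 := by
  have h1 := eulerMascheroniConstant_le_harmonic_sub_log 81
  have h2 : Real.log ((81 : ℕ) + 1 / 2) + Real.log (4 * π) =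
      10 * Real.log 2 + Real.log (326 * π / 1024) := by
    rw [show (10 : ℝ) = (10 : ℕ) by norm_num, ← Real.log_pow, ← Real.log_mul (by norm_num)
      (by positivity), ← Real.log_mul (by norm_num) (by positivity)]
    congr 1
    norm_num
    ring
  have h3 := Real.one_sub_inv_le_log_of_pos (x := 326 * π / 1024) (by positivity)
  have h4 : (326 * π / 1024)⁻¹ ≤ (326 * 3.141592 / 1024)⁻¹ := by
    have := Real.pi_gt_d6
    gcongr
  have h5 := Real.log_two_gt_d9
  have h6 : (harmonic 81 : ℝ) ≤ 4.977825 := by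
    have : harmonic 81 ≤ 4.977825 := by
      norm_num [harmonic, Finset.sum_range_succ]
    have h7 : ((harmonic 81 : ℚ) : ℝ) ≤ ((4.977825 : ℚ) : ℝ) := by exact_mod_cast this
    refine h7.trans (le_of_eq (by norm_num))
  have h8 : (326 * 3.141592 / 1024 : ℝ)⁻¹ ≤ 0.9998448 := by norm_num
  linarith

theorem log_two_pi_le : Real.log (2 * π) ≤ 1.838 := by
  have h1 : 3 * Real.log (2 * π) + Real.log (256 / (2 * π) ^ 3) = 8 * Real.log 2 := by
    rw [show (8 : ℝ) = (8 : ℕ) by norm_num, ← Real.log_pow, show (3 : ℝ) = (3 : ℕ) by norm_num,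
      ← Real.log_pow, ← Real.log_mul (by positivity) (by positivity)]
    congr 1
    field_simp
    norm_num
  have h2 := Real.le_log_one_add_of_nonneg (x := 0.032) (by norm_num)
  have h3 : Real.log (1 + 0.032) ≤ Real.log (256 / (2 * π) ^ 3) := by
    apply Real.log_le_log (by norm_num)
    rw [le_div_iff₀ (by positivity)]
    have h4 : (2 * π) ^ 3 ≤ (2 * 3.141593) ^ 3 := by
      have := Real.pi_lt_d6
      gcongr
    norm_num at h4 ⊢
    linarith
  have h5 := Real.log_two_lt_d9
  norm_num at h2 h3 ⊢
  linarith

theorem norm_explicit_term_le (hRH : RiemannHypothesis) {x : ℝ} (hx : 1 ≤ x) (z : ZetaZero) :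
    ‖(zetaMult z : ℂ) / (z * (z + 1)) * ((x : ℂ) ^ (z.1 + 1) - 1)‖ ≤
      zeroMajorant (x ^ (3 / 2 : ℝ) + 1) z := by
  have hx0 : 0 < x := by linarith
  have hz0 := norm_pos_iff.2 z.ne_zero
  rw [norm_mul, norm_div, norm_mul, Complex.norm_natCast, zeroMajorant]
  have hle : ‖(x : ℂ) ^ (z.1 + 1) - 1‖ ≤ x ^ (z.1.re + 1) + 1 := by
    refine (norm_sub_le _ _).trans ?_
    rw [Complex.norm_cpow_eq_rpow_re_of_pos hx0]
    simp
  split_ifs with h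
  · rw [h, show (1 / 2 + 1 : ℝ) = 3 / 2 by norm_num] at hle
    rw [mul_comm, pow_two]
    have := norm_le_norm_add_one h
    gcongr
  · obtain ⟨n, hn⟩ := (riemannZeta₁_eq_zero_imp hRH z.2).resolve_right h
    refine mul_le_of_le_one_right (by positivity) ?_
    have e : z.1 + 1 = ((-(2 * n + 1) : ℝ) : ℂ) := by rw [hn]; push_cast; ring
    rw [e, ← Complex.ofReal_cpow hx0.le, ← Complex.ofReal_one, ← Complex.ofReal_sub,
      Complex.norm_real, Real.norm_eq_abs, abs_le]
    have h1 := Real.rpow_pos_of_pos hx0 (-(2 * (n : ℝ) + 1))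
    have h2 : x ^ (-(2 * (n : ℝ) + 1)) ≤ 1 :=
      Real.rpow_le_one_of_one_le_of_nonpos hx (by
        have : (0 : ℝ) ≤ n := n.cast_nonneg
        linarith)
    constructor <;> linarith

end

theorem psiOne_bound (hRH : RiemannHypothesis) :
    ∀ x : ℝ, 1 ≤ x →
      |psiOne x - x ^ 2 / 2| ≤ 0.0462 * x ^ ((3 : ℝ) / 2) + 1.838 * x := by
  intro x hx
  have hpow : 0 < x ^ (3 / 2 : ℝ) := Real.rpow_pos_of_pos (by linarith) _
  have hc : 0 ≤ x ^ (3 / 2 : ℝ) + 1 := by positivity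
  have h1 : |(x ^ 2 - 1) / 2 - Real.log (2 * π) * (x - 1) - psiOne x| ≤
      (x ^ (3 / 2 : ℝ) + 1) * (eulerMascheroniConstant + 2 - Real.log (4 * π)) + 3 / 4 := by
    rw [← Real.norm_eq_abs, ← Complex.norm_real, ← (hasSum_psiOne_explicit hRH hx).tsum_eq]
    exact (tsum_of_norm_bounded (summable_zeroMajorant hRH hc).hasSum
      (norm_explicit_term_le hRH hx)).trans (tsum_zeroMajorant_le hRH hc)
  have h2 := mul_le_mul_of_nonneg_left eulerMascheroniConstant_add_two_sub_log_le hc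
  have h3 := log_two_pi_le
  have h4 : 1.38 ≤ Real.log (2 * π) := by
    have h5 : Real.log (2 ^ 2) ≤ Real.log (2 * π) :=
      Real.log_le_log (by norm_num) (by linarith [Real.pi_gt_three])
    rw [Real.log_pow] at h5
    have := Real.log_two_gt_d9
    push_cast at h5
    linarith
  obtain ⟨h6, h7⟩ := abs_le.1 h1
  rw [abs_le]
  constructor <;> nlinarith
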